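/- (Weil–Estermann bound for Kloosterman sums) For every positive integer q and all integers m and n, the Kloosterman sum K(q; m, n) = ∑_{1 ≤ x ≤ q, gcd(x,q)=1} e((m·x + n·x̄)/q) satisfies |K(q; m, n)| ≤ τ(q)·q^{1/2}·gcd(m, n, q)^{1/2}, where x̄ denotes the multiplicative inverse of x modulo q. -/

import Mathlib

/-- `e(α) = exp(2πiα)`. -/
noncomputable def eAdd (α : ℝ) : ℂ := Complex.exp (2 * Real.pi * Complex.I * α)

open Polynomial in
theorem exists_ne_zero_sum_smul_eq_zero {F R ι : Type*} [Field F] [CommRing R] [Algebra F R]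
    [Module.Finite F R] [Fintype ι] (H : ι → R[X]) (B : ℕ) (hH : ∀ i, (H i).natDegree < B)
    (hB : B * Module.finrank F R < Fintype.card ι) :
    ∃ r : ι → F, r ≠ 0 ∧ ∑ i, r i • H i = 0 := by
  let L : (ι → F) →ₗ[F] (Fin B → R) :=
    { toFun := fun r b => (∑ i, r i • H i).coeff b
      map_add' := fun r s => by ext b; simp [add_smul, Finset.sum_add_distrib]
      map_smul' := fun a r => by ext b; simp [mul_smul, Finset.smul_sum] }
  have hL : LinearMap.ker L ≠ ⊥ := by
    apply LinearMap.ker_ne_bot_of_finrank_lt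
    rw [Module.finrank_fintype_fun_eq_card, Module.finrank_pi_fintype]
    simpa using hB
  obtain ⟨r, hr, hr0⟩ := (Submodule.ne_bot_iff _).1 hL
  refine ⟨r, hr0, ?_⟩
  ext b
  by_cases hb : b < B
  · exact congrFun (LinearMap.mem_ker.1 hr) ⟨b, hb⟩
  · rw [coeff_zero]
    apply coeff_eq_zero_of_natDegree_lt
    refine lt_of_le_of_lt (natDegree_sum_le_of_forall_le (n := B - 1) _ _ fun i _ => ?_) ?_
    · exact (natDegree_smul_le _ _).trans (by have := hH i; omega)
    · have : B ≠ 0 := by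
        rintro rfl
        obtain ⟨i, -⟩ := Function.ne_iff.1 hr0
        exact absurd (hH i) (by simp)
      omega

open Polynomial in
theorem sum_smul_ne_zero_of_natDegree_injective {F ι : Type*} [Field F] [Fintype ι]
    (M : ι → F[X]) (hM : ∀ i, M i ≠ 0) (hd : Function.Injective fun i => (M i).natDegree)
    (r : ι → F) (hr : r ≠ 0) : ∑ i, r i • M i ≠ 0 := by
  intro h
  obtain ⟨i, hi⟩ := Function.ne_iff.1 hr
  have hdeg : ∀ j, r j ≠ 0 → (r j • M j).degree = (M j).natDegree := fun j hj => by
    rw [degree_smul_of_smul_regular _ (IsSMulRegular.of_ne_zero hj),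
      degree_eq_natDegree (hM j)]
  have := degree_sum_eq_of_disjoint (fun j => r j • M j) Finset.univ (by
    rintro a ⟨-, ha⟩ b ⟨-, hb⟩ hab
    have ha' : r a ≠ 0 := fun h => ha (by simp [h])
    have hb' : r b ≠ 0 := fun h => hb (by simp [h])
    simp only [Function.onFun, Function.comp, hdeg a ha', hdeg b hb']
    exact fun h => hab (hd (by exact_mod_cast h)))
  rw [h, degree_zero, eq_comm, Finset.sup_eq_bot_iff] at this
  have h2 := this i (Finset.mem_univ i)
  rw [hdeg i hi] at h2
  exact absurd h2 (by simp)

open Polynomial in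
theorem mul_card_le_natDegree {F : Type*} [Field F] (P : F[X]) (hP : P ≠ 0) (l : ℕ)
    (S : Finset F) (h : ∀ x ∈ S, (X - C x) ^ l ∣ P) : l * S.card ≤ P.natDegree := by
  have h1 : ∏ x ∈ S, (X - C x) ^ l ∣ P := by
    apply Finset.prod_dvd_of_coprime _ h
    intro a _ b _ hab
    exact (pairwise_coprime_X_sub_C (s := fun x : F => x) (fun _ _ h => h) hab).pow
  have h2 := natDegree_le_of_dvd h1 hP
  rw [natDegree_prod_of_monic _ _ fun x _ => (monic_X_sub_C x).pow l] at h2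
  simpa [mul_comm] using h2

open Polynomial in
theorem X_sub_C_pow_dvd_of_aeval_eq_zero {F : Type*} [Field F] (P : F[X]) (l : ℕ) (x : F)
    (hx : x ≠ 0)
    (h : aeval (algebraMap F (AdjoinRoot ((X - 1 : F[X]) ^ l)) x * AdjoinRoot.root _) P = 0) :
    (X - C x) ^ l ∣ P := by
  have h1 : AdjoinRoot.mk ((X - 1 : F[X]) ^ l) (P.comp (C x * X)) = 0 := by
    rw [← AdjoinRoot.aeval_eq, aeval_comp]
    simpa using h
  rw [AdjoinRoot.mk_eq_zero] at h1
  obtain ⟨g, hg⟩ := h1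
  have h2 := congrArg (fun f => f.comp (C x⁻¹ * X)) hg
  simp only [comp_assoc, mul_comp, C_comp, X_comp, pow_comp, sub_comp, one_comp] at h2
  rw [← mul_assoc, ← C_mul, mul_inv_cancel₀ hx, C_1, one_mul, comp_X] at h2
  have h3 : (C x⁻¹ * X - 1 : F[X]) = C x⁻¹ * (X - C x) := by
    rw [mul_sub, ← C_mul, inv_mul_cancel₀ hx, C_1]
  rw [h2, h3, mul_pow, mul_assoc]
  exact (Dvd.intro _ rfl).mul_left _

open Polynomial in
/-- The polynomial `X ^ Q * ∑_{i < 2 * r + 2} (X ^ (p^i) + c ^ (p^i) * X ^ (-p^i))`,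
`Q = p ^ (2 * r + 1)`. -/
noncomputable def tracePoly {F : Type*} [Field F] (p r : ℕ) (c : F) : F[X] :=
  ∑ i ∈ Finset.range (2 * r + 2),
    (X ^ (p ^ (2 * r + 1) + p ^ i) + C (c ^ p ^ i) * X ^ (p ^ (2 * r + 1) - p ^ i))

open Polynomial in
theorem tracePoly_monic {F : Type*} [Field F] (p r : ℕ) [hp : Fact p.Prime] (c : F) :
    (tracePoly p r c).Monic ∧ (tracePoly p r c).natDegree = 2 * p ^ (2 * r + 1) := by
  set Q := p ^ (2 * r + 1) with hQ
  have hQ0 : 0 < Q := pow_pos hp.out.pos _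
  have key : ∃ g : F[X], g.degree < ((2 * Q : ℕ) : WithBot ℕ) ∧
      tracePoly p r c = X ^ (2 * Q) + g := by
    refine ⟨(∑ i ∈ Finset.range (2 * r + 1), (X ^ (Q + p ^ i) + C (c ^ p ^ i) * X ^ (Q - p ^ i)))
      + C (c ^ Q), ?_, ?_⟩
    · have hlt : ∀ (g : F[X]), g.natDegree < 2 * Q → g.degree < ((2 * Q : ℕ) : WithBot ℕ) :=
        fun g hg => lt_of_le_of_lt degree_le_natDegree (by exact_mod_cast hg)
      refine lt_of_le_of_lt (degree_add_le _ _) (max_lt ?_ (hlt _ (by simp [hQ0])))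
      apply hlt
      refine lt_of_le_of_lt (natDegree_sum_le_of_forall_le (n := 2 * Q - 1) _ _ fun i hi => ?_)
        (by omega)
      have hi' : p ^ i < Q := Nat.pow_lt_pow_right hp.out.one_lt (Finset.mem_range.1 hi)
      refine (natDegree_add_le _ _).trans (max_le ?_ ?_)
      · rw [natDegree_X_pow]; omega
      · refine (natDegree_C_mul_X_pow_le _ _).trans (by omega)
    · rw [tracePoly, Finset.sum_range_succ, ← hQ]
      simp only [Nat.sub_self, pow_zero, mul_one]
      ring
  obtain ⟨g, hg, h⟩ := key
  rw [h]
  refine ⟨monic_X_pow_add hg, ?_⟩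
  rw [natDegree_add_eq_left_of_degree_lt (by rwa [degree_X_pow]), natDegree_X_pow]

open Polynomial in
/-- The deviation of `tracePoly` under `X ↦ w * X` for `w ^ p ^ (r+1) = 1`. -/
noncomputable def traceShift {F R : Type*} [Field F] [CommRing R] [Algebra F R] (p r : ℕ) (c : F)
    (w : R) : R[X] :=
  ∑ i ∈ Finset.range (r + 1),
    (C (w ^ p ^ i - 1) * X ^ (p ^ r + p ^ i) +
      C (algebraMap F R (c ^ p ^ i) * ((w ^ (p ^ (r + 1) - 1)) ^ p ^ i - 1)) * X ^ (p ^ r - p ^ i))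

open Polynomial in
theorem traceShift_natDegree_le {F R : Type*} [Field F] [CommRing R] [Algebra F R] (p r : ℕ)
    [hp : Fact p.Prime] (c : F) (w : R) : (traceShift p r c w).natDegree ≤ 2 * p ^ r := by
  refine natDegree_sum_le_of_forall_le _ _ fun i hi => ?_
  have hi' : p ^ i ≤ p ^ r := Nat.pow_le_pow_right hp.out.pos (by simpa [Nat.lt_succ_iff] using hi)
  refine (natDegree_add_le _ _).trans (max_le ?_ ?_)
  · exact (natDegree_C_mul_X_pow_le _ _).trans (by omega)
  · exact (natDegree_C_mul_X_pow_le _ _).trans (by omega)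

open Polynomial in
theorem aeval_tracePoly {F R : Type*} [Field F] [CommRing R] [Algebra F R] (p r : ℕ)
    [hp : Fact p.Prime] (c t : F) (w : R) (hw : w ^ p ^ (r + 1) = 1) (x : F) (hx : x ≠ 0)
    (ht : ∑ i ∈ Finset.range (2 * r + 2), (x ^ p ^ i + c ^ p ^ i * x⁻¹ ^ p ^ i) = t) :
    algebraMap F R x ^ p ^ r * aeval (algebraMap F R x * w) (tracePoly p r c) =
      algebraMap F R x ^ p ^ (2 * r + 1) *
        (algebraMap F R t * algebraMap F R x ^ p ^ r +
          (traceShift p r c w).eval (algebraMap F R x)) := by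
  set y := algebraMap F R x
  set yi := algebraMap F R x⁻¹
  have hyy : y * yi = 1 := by rw [← map_mul, mul_inv_cancel₀ hx, map_one]
  have hl : 0 < p ^ (r + 1) := pow_pos hp.out.pos _
  set wi := w ^ (p ^ (r + 1) - 1) with hwi
  have hww : w * wi = 1 := by rw [hwi, ← pow_succ', Nat.sub_add_cancel hl, hw]
  have hsub : ∀ (z zi : R) (_ : z * zi = 1) (m k : ℕ), k ≤ m → z ^ (m - k) = z ^ m * zi ^ k := by
    intro z zi h m k hk
    obtain ⟨e, rfl⟩ := Nat.exists_eq_add_of_le hk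
    rw [Nat.add_sub_cancel_left, pow_add, mul_comm (z ^ k), mul_assoc, ← mul_pow, h, one_pow,
      mul_one]
  have hQ : (y * w) ^ p ^ (2 * r + 1) = y ^ p ^ (2 * r + 1) := by
    rw [mul_pow, show 2 * r + 1 = (r + 1) + r by ring, pow_add p (r + 1) r, pow_mul w, hw, one_pow,
      mul_one]
  have hwhi : ∀ i, w ^ p ^ (r + 1 + i) = 1 := fun i => by rw [pow_add p, pow_mul, hw, one_pow]
  have hwihi : ∀ i, wi ^ p ^ (r + 1 + i) = 1 := fun i => by
    have := congrArg (· ^ p ^ (r + 1 + i)) hww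
    simpa [mul_pow, hwhi] using this
  set γ := algebraMap F R c
  have e1 : aeval (y * w) (tracePoly p r c) = y ^ p ^ (2 * r + 1) *
      ∑ i ∈ Finset.range (2 * r + 2),
        (y ^ p ^ i * w ^ p ^ i + γ ^ p ^ i * (yi ^ p ^ i * wi ^ p ^ i)) := by
    rw [tracePoly, map_sum, Finset.mul_sum]
    refine Finset.sum_congr rfl fun i hi => ?_
    have hi' : p ^ i ≤ p ^ (2 * r + 1) :=
      Nat.pow_le_pow_right hp.out.pos (by have := Finset.mem_range.1 hi; omega)
    simp only [map_add, map_mul, map_pow, aeval_X, aeval_C]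
    rw [hsub (y * w) (yi * wi) (by linear_combination w * wi * hyy + hww) _ _ hi', pow_add, hQ]
    ring
  have e2 : algebraMap F R t = ∑ i ∈ Finset.range (2 * r + 2),
      (y ^ p ^ i + γ ^ p ^ i * yi ^ p ^ i) := by
    rw [← ht]; simp only [map_sum, map_add, map_mul, map_pow, y, yi, γ]
  have e3 : (traceShift p r c w).eval y = y ^ p ^ r * ∑ i ∈ Finset.range (r + 1),
      ((w ^ p ^ i - 1) * y ^ p ^ i + γ ^ p ^ i * (wi ^ p ^ i - 1) * yi ^ p ^ i) := by
    rw [traceShift, eval_finsetSum, Finset.mul_sum]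
    refine Finset.sum_congr rfl fun i hi => ?_
    have hi' : p ^ i ≤ p ^ r :=
      Nat.pow_le_pow_right hp.out.pos (by have := Finset.mem_range.1 hi; omega)
    simp only [eval_add, eval_mul, eval_pow, eval_X, eval_C]
    rw [hsub y yi hyy _ _ hi', map_pow]
    ring
  rw [e1, e2, e3, show 2 * r + 2 = (r + 1) + (r + 1) by ring,
    Finset.sum_range_add _ (r + 1) (r + 1),
    Finset.sum_range_add _ (r + 1) (r + 1)]
  simp only [hwhi, hwihi]
  have e4 : ∑ i ∈ Finset.range (r + 1),
        (y ^ p ^ i * w ^ p ^ i + γ ^ p ^ i * (yi ^ p ^ i * wi ^ p ^ i)) =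
      ∑ i ∈ Finset.range (r + 1), (y ^ p ^ i + γ ^ p ^ i * yi ^ p ^ i) +
      ∑ i ∈ Finset.range (r + 1),
      ((w ^ p ^ i - 1) * y ^ p ^ i + γ ^ p ^ i * (wi ^ p ^ i - 1) * yi ^ p ^ i) := by
    rw [← Finset.sum_add_distrib]
    exact Finset.sum_congr rfl fun i _ => by ring
  rw [e4]
  simp only [mul_one]
  ring

open Polynomial in
/-- Stepanov's bound for the number of `x` with `x + c / x` of given trace. -/
theorem card_le_of_trace_eq {F : Type*} [Field F] (p r : ℕ) [hp : Fact p.Prime] [CharP F p]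
    (c t : F) (S : Finset F)
    (hS : ∀ x ∈ S, x ≠ 0 ∧ x ^ p ^ (2 * r + 2) = x ∧
      ∑ i ∈ Finset.range (2 * r + 2), (x ^ p ^ i + c ^ p ^ i * x⁻¹ ^ p ^ i) = t) :
    S.card ≤ p ^ (r + 1) * (p ^ r + 7) := by
  set l := p ^ (r + 1) with hl
  set lam := p ^ r with hlam
  set Q := p ^ (2 * r + 1) with hQ
  set q := p ^ (2 * r + 2) with hq
  have hp2 := hp.out.two_le
  have hlam0 : 0 < lam := pow_pos hp.out.pos _
  have hl_lam : l = p * lam := by rw [hl, hlam]; ring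
  have hQl : Q = lam * l := by rw [hQ, hlam, hl]; ring
  have hqQ : q = p * Q := by rw [hq, hQ]; ring
  have hql : q = l * l := by rw [hq, hl]; ring
  have h2l : 2 * lam ≤ l := by rw [hl_lam]; gcongr
  set J := lam + 6 with hJ
  have hQ0 : 0 < Q := pow_pos hp.out.pos _
  let R := AdjoinRoot ((X - 1 : F[X]) ^ l)
  have hmon : ((X - 1 : F[X]) ^ l).Monic := by simpa using (monic_X_sub_C (1 : F)).pow l
  have hnd : ((X - 1 : F[X]) ^ l).natDegree = l := by
    rw [natDegree_pow]; simpa using congrArg (l * ·) (natDegree_X_sub_C (1 : F))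
  let w : R := AdjoinRoot.root _
  have hw : w ^ l = 1 := by
    have h1 : (X - 1 : F[X]) ^ l = X ^ l - 1 := by rw [hl, sub_pow_char_pow, one_pow]
    have h2 := congrArg (AdjoinRoot.mk ((X - 1 : F[X]) ^ l)) h1
    rw [AdjoinRoot.mk_self, map_sub, map_pow, map_one, eq_comm, sub_eq_zero] at h2
    exact h2
  have hfin : Module.Finite F R := (AdjoinRoot.powerBasis hmon.ne_zero).finite
  have hrank : Module.finrank F R = l := by
    rw [(AdjoinRoot.powerBasis hmon.ne_zero).finrank, AdjoinRoot.powerBasis_dim, hnd]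
  let ι := Fin p × Fin J × Fin Q
  let V := tracePoly p r c
  obtain ⟨hVm, hVd⟩ := tracePoly_monic p r c
  let M : ι → F[X] := fun s =>
    X ^ (s.2.2 : ℕ) * V ^ (s.1 : ℕ) * X ^ (Q * (p - 1 - s.1) + s.2.1 * q)
  let E := traceShift p r c w
  let H : ι → R[X] := fun s =>
    C (w ^ (s.2.2 : ℕ)) * X ^ (s.2.2 : ℕ) * (C (algebraMap F R t) * X ^ lam + E) ^ (s.1 : ℕ) *
      X ^ (lam * (p - 1 - s.1) + s.2.1)
  have hHd : ∀ s, (H s).natDegree < Q + J + 2 * l := by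
    rintro ⟨⟨i, hi⟩, ⟨j, hj⟩, ⟨a, ha⟩⟩
    have d1 : (C (algebraMap F R t) * X ^ lam + E).natDegree ≤ 2 * lam := by
      refine (natDegree_add_le _ _).trans (max_le ?_ (traceShift_natDegree_le p r c w))
      exact (natDegree_C_mul_X_pow_le _ _).trans (by omega)
    have d2 : (H (⟨i, hi⟩, ⟨j, hj⟩, ⟨a, ha⟩)).natDegree ≤
        a + i * (2 * lam) + (lam * (p - 1 - i) + j) := by
      refine natDegree_mul_le.trans (add_le_add (natDegree_mul_le.trans (add_le_add ?_ ?_)) ?_)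
      · exact natDegree_C_mul_X_pow_le _ _
      · exact natDegree_pow_le.trans (by gcongr)
      · exact natDegree_X_pow_le _
    have d3 : i * (2 * lam) + lam * (p - 1 - i) ≤ 2 * l := by
      obtain ⟨e, he⟩ : ∃ e, p = i + e + 1 := ⟨p - i - 1, by omega⟩
      rw [show p - 1 - i = e by omega, hl_lam, he]
      nlinarith
    omega
  have hcard : (Q + J + 2 * l) * Module.finrank F R < Fintype.card ι := by
    rw [hrank]
    simp only [ι, Fintype.card_prod, Fintype.card_fin]
    rw [show p * (J * Q) = J * q by rw [hqQ]; ring, hql, hQl, ← mul_assoc]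
    refine Nat.mul_lt_mul_of_pos_right ?_ (pow_pos hp.out.pos (r + 1))
    rw [hJ]; nlinarith
  obtain ⟨ρ, hρ0, hρ⟩ := exists_ne_zero_sum_smul_eq_zero H _ hHd hcard
  have hMne : ∀ s, (M s).Monic := fun s =>
    ((monic_X_pow _).mul (hVm.pow _)).mul (monic_X_pow _)
  have hMd : ∀ s : ι, (M s).natDegree =
      s.2.2 + Q * (p - 1) + Q * (s.1 + p * s.2.1) := by
    rintro ⟨⟨i, hi⟩, ⟨j, hj⟩, ⟨a, ha⟩⟩
    simp only [M]
    rw [((monic_X_pow _).mul (hVm.pow _)).natDegree_mul (monic_X_pow _),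
      (monic_X_pow _).natDegree_mul (hVm.pow _), hVm.natDegree_pow, natDegree_X_pow,
      natDegree_X_pow, hVd, ← hQ, hqQ]
    obtain ⟨e, he⟩ : ∃ e, p = i + e + 1 := ⟨p - i - 1, by omega⟩
    rw [show p - 1 - i = e by omega, show p - 1 = i + e by omega]
    ring
  have hMinj : Function.Injective fun s => (M s).natDegree := by
    rintro ⟨⟨i, hi⟩, ⟨j, hj⟩, ⟨a, ha⟩⟩ ⟨⟨i', hi'⟩, ⟨j', hj'⟩, ⟨a', ha'⟩⟩ h
    simp only [hMd] at h
    have h1 : a + Q * (i + p * j) = a' + Q * (i' + p * j') := by omega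
    have h2 : a = a' := by
      have := congrArg (· % Q) h1
      simpa [Nat.add_mul_mod_self_left, Nat.mod_eq_of_lt ha, Nat.mod_eq_of_lt ha'] using this
    subst h2
    have h3 : i + p * j = i' + p * j' := Nat.eq_of_mul_eq_mul_left hQ0 (by omega)
    have h4 : i = i' := by
      have := congrArg (· % p) h3
      simpa [Nat.add_mul_mod_self_left, Nat.mod_eq_of_lt hi, Nat.mod_eq_of_lt hi'] using this
    subst h4
    have h5 : j = j' := Nat.eq_of_mul_eq_mul_left hp.out.pos (by omega)
    subst h5
    rfl
  set P := ∑ s, ρ s • M s with hP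
  have hP0 : P ≠ 0 := sum_smul_ne_zero_of_natDegree_injective M (fun s => (hMne s).ne_zero)
    hMinj ρ hρ0
  have hPd : P.natDegree ≤ (J + 1) * q := by
    refine natDegree_sum_le_of_forall_le _ _ fun s _ => (natDegree_smul_le _ _).trans ?_
    rw [hMd]
    obtain ⟨⟨i, hi⟩, ⟨j, hj⟩, ⟨a, ha⟩⟩ := s
    simp only
    have h1 : Q * (i + p * j) ≤ Q * ((p - 1) + p * (J - 1)) := by gcongr <;> omega
    obtain ⟨e, he⟩ : ∃ e, p = e + 1 := ⟨p - 1, by omega⟩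
    rw [show p - 1 = e by omega] at *
    rw [show J - 1 = lam + 5 by omega] at h1
    rw [hqQ, hJ]
    nlinarith
  have hdvd : ∀ x ∈ S, (X - C x) ^ l ∣ P := by
    intro x hx
    obtain ⟨hx0, hxq, hxt⟩ := hS x hx
    apply X_sub_C_pow_dvd_of_aeval_eq_zero P l x hx0
    change aeval (algebraMap F R x * w) P = 0
    set y := algebraMap F R x with hy
    have hyu : IsUnit y := (IsUnit.mk0 x hx0).map (algebraMap F R)
    have hV := aeval_tracePoly p r c t w hw x hx0 hxt
    have hyQ : (y * w) ^ Q = y ^ Q := by rw [mul_pow, hQl, mul_comm lam, pow_mul w, hw, one_pow,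
      mul_one]
    have hyq : (y * w) ^ q = y := by
      rw [mul_pow, hql, pow_mul w, hw, one_pow, mul_one, ← hql, hy, ← map_pow, hxq]
    have hterm : ∀ s, y ^ (lam * (p - 1)) * aeval (y * w) (M s) =
        y ^ (Q * (p - 1)) * (H s).eval y := by
      rintro ⟨⟨i, hi⟩, ⟨j, hj⟩, ⟨a, ha⟩⟩
      have e1 : (y ^ lam) ^ i * (aeval (y * w) V) ^ i =
          (y ^ Q) ^ i * (algebraMap F R t * y ^ lam + E.eval y) ^ i := by
        rw [← mul_pow, hV, mul_pow]
      simp only [M, H, map_mul, map_pow, aeval_X, eval_mul, eval_pow, eval_X, eval_C, eval_add]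
      obtain ⟨e, he⟩ : ∃ e, p = i + e + 1 := ⟨p - i - 1, by omega⟩
      rw [show p - 1 - i = e by omega, show p - 1 = i + e by omega, pow_add (y * w),
        pow_mul (y * w) Q e,
        mul_comm j q, pow_mul _ q, hyQ, hyq, mul_pow y w a]
      simp only [pow_mul, pow_add, mul_add]
      linear_combination (y ^ a * w ^ a * (y ^ lam) ^ e * (y ^ Q) ^ e * y ^ j) * e1
    have hsum : y ^ (lam * (p - 1)) * aeval (y * w) P = 0 := by
      have e2 := congrArg (eval y) hρ
      rw [eval_finsetSum, eval_zero] at e2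
      rw [hP, map_sum, Finset.mul_sum, ← mul_zero (y ^ (Q * (p - 1))), ← e2, Finset.mul_sum]
      refine Finset.sum_congr rfl fun s _ => ?_
      rw [map_smul, eval_smul, mul_smul_comm, mul_smul_comm, hterm]
    exact (hyu.pow _).mul_right_eq_zero.1 hsum
  have hfinal := (mul_card_le_natDegree P hP0 l S hdvd).trans hPd
  rw [hql] at hfinal
  refine Nat.le_of_mul_le_mul_left (hfinal.trans (le_of_eq ?_)) (pow_pos hp.out.pos (r + 1))
  rw [hJ]; ring

open Polynomial in
open Classical in
/-- The completely multiplicative weight on monic polynomials whose value at `X - x` is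
`ψ (x + c / x)`. -/
noncomputable def kloostermanWeight {K : Type*} [Field K] (ψ : AddChar K ℂ) (c : K)
    (f : K[X]) : ℂ :=
  if f.coeff 0 = 0 then 0 else ψ (-(f.nextCoeff + c * (f.coeff 1 / f.coeff 0)))

open Polynomial in
theorem kloostermanWeight_one {K : Type*} [Field K] (ψ : AddChar K ℂ) (c : K) :
    kloostermanWeight ψ c 1 = 1 := by
  simp [kloostermanWeight, nextCoeff, coeff_one]

open Polynomial in
theorem kloostermanWeight_mul {K : Type*} [Field K] (ψ : AddChar K ℂ) (c : K) {f g : K[X]}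
    (hf : f.Monic) (hg : g.Monic) :
    kloostermanWeight ψ c (f * g) = kloostermanWeight ψ c f * kloostermanWeight ψ c g := by
  unfold kloostermanWeight
  by_cases h1 : f.coeff 0 = 0
  · simp [mul_coeff_zero, h1]
  by_cases h2 : g.coeff 0 = 0
  · simp [mul_coeff_zero, h2]
  rw [if_neg h1, if_neg h2, if_neg (by simp [mul_coeff_zero, h1, h2]), ← AddChar.map_add_eq_mul,
    hf.nextCoeff_mul hg, mul_coeff_zero, mul_coeff_one]
  congr 1
  field_simp
  ring

open Polynomial in
theorem kloostermanWeight_pow {K : Type*} [Field K] (ψ : AddChar K ℂ) (c : K) {f : K[X]}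
    (hf : f.Monic) (e : ℕ) :
    kloostermanWeight ψ c (f ^ e) = kloostermanWeight ψ c f ^ e := by
  induction e with
  | zero => simp [kloostermanWeight_one]
  | succ e ih => rw [pow_succ, kloostermanWeight_mul ψ c (hf.pow e) hf, ih, pow_succ]

open Polynomial in
/-- Monic polynomials of degree `d` correspond to their lower coefficients. -/
noncomputable def monicEquivFun (K : Type*) [Field K] (d : ℕ) :
    {f : K[X] // f.Monic ∧ f.natDegree = d} ≃ (Fin d → K) :=
  (monicEquivDegreeLT d).trans (degreeLTEquiv K d).toEquiv

open Polynomial in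
theorem monicEquivFun_symm_coeff {K : Type*} [Field K] (d : ℕ) (v : Fin d → K) (i : Fin d) :
    ((monicEquivFun K d).symm v).1.coeff i = v i := by
  have h := congrFun ((monicEquivFun K d).apply_symm_apply v) i
  rw [← h]
  generalize (monicEquivFun K d).symm v = f
  simp only [monicEquivFun, monicEquivDegreeLT, degreeLTEquiv, Equiv.trans_apply, Equiv.coe_fn_mk,
    LinearEquiv.coe_toEquiv]
  change _ = (f.1.eraseLead).coeff i
  rw [eraseLead_coeff_of_ne]
  rw [f.2.2]
  exact i.2.ne

open Polynomial in
/-- The finset of monic polynomials of degree `d`. -/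
noncomputable def monicOfDegree (K : Type*) [Field K] [Fintype K] (d : ℕ) : Finset K[X] :=
  Finset.univ.map ((monicEquivFun K d).symm.toEmbedding.trans (Function.Embedding.subtype _))

open Polynomial in
theorem mem_monicOfDegree {K : Type*} [Field K] [Fintype K] {d : ℕ} {f : K[X]} :
    f ∈ monicOfDegree K d ↔ f.Monic ∧ f.natDegree = d := by
  simp only [monicOfDegree, Finset.mem_map, Finset.mem_univ, true_and]
  constructor
  · rintro ⟨v, rfl⟩
    exact ((monicEquivFun K d).symm v).2
  · exact fun h => ⟨monicEquivFun K d ⟨f, h⟩, by simp⟩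

open Polynomial in
/-- The coefficients of the `L`-function attached to a Kloosterman sum. -/
noncomputable def kloostermanCoeff {K : Type*} [Field K] [Fintype K] (ψ : AddChar K ℂ) (c : K)
    (d : ℕ) : ℂ :=
  ∑ f ∈ monicOfDegree K d, kloostermanWeight ψ c f

open Polynomial in
open Classical in
/-- The finset of monic irreducible polynomials of degree at most `d`. -/
noncomputable def monicIrreducibles (K : Type*) [Field K] [Fintype K] (d : ℕ) : Finset K[X] :=
  ((Finset.range (d + 1)).biUnion (monicOfDegree K)).filter Irreducible

open Polynomial in
theorem mem_monicIrreducibles {K : Type*} [Field K] [Fintype K] {d : ℕ} {f : K[X]} :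
    f ∈ monicIrreducibles K d ↔ f.Monic ∧ f.natDegree ≤ d ∧ Irreducible f := by
  simp only [monicIrreducibles, Finset.mem_filter, Finset.mem_biUnion, Finset.mem_range,
    mem_monicOfDegree]
  constructor
  · rintro ⟨⟨n, hn, h, rfl⟩, hi⟩
    exact ⟨h, by omega, hi⟩
  · rintro ⟨h, hn, hi⟩
    exact ⟨⟨_, by omega, h, rfl⟩, hi⟩

open Polynomial UniqueFactorizationMonoid in
open Classical in
theorem sum_natDegree_of_pow_dvd {K : Type*} [Field K] [Fintype K] {d : ℕ} {f : K[X]}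
    (hf : f ∈ monicOfDegree K d) :
    ∑ P ∈ monicIrreducibles K d, ∑ e ∈ Finset.Icc 1 d, (if P ^ e ∣ f then P.natDegree else 0) =
      d := by
  obtain ⟨hm, hd⟩ := mem_monicOfDegree.1 hf
  have hf0 := hm.ne_zero
  have hmonic : ∀ P ∈ normalizedFactors f, P.Monic := fun P hP => by
    rw [← normalize_normalized_factor P hP]
    exact monic_normalize (irreducible_of_normalized_factor P hP).ne_zero
  have hprod : (normalizedFactors f).prod = f := by
    rw [prod_normalizedFactors_eq hf0, hm.normalize_eq_self]
  have hdeg : ∑ P ∈ (normalizedFactors f).toFinset,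
      (normalizedFactors f).count P * P.natDegree = d := by
    rw [← hd]
    conv_rhs => rw [← hprod]
    rw [natDegree_multiset_prod_of_monic _ hmonic, Finset.sum_multiset_map_count]
    simp
  have hsub : (normalizedFactors f).toFinset ⊆ monicIrreducibles K d := by
    intro P hP
    rw [Multiset.mem_toFinset] at hP
    exact mem_monicIrreducibles.2 ⟨hmonic P hP, hd ▸ natDegree_le_of_dvd
      (dvd_of_mem_normalizedFactors hP) hf0, irreducible_of_normalized_factor P hP⟩
  have hinner : ∀ P ∈ monicIrreducibles K d,
      ∑ e ∈ Finset.Icc 1 d, (if P ^ e ∣ f then P.natDegree else 0) =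
        (normalizedFactors f).count P * P.natDegree := by
    intro P hP
    obtain ⟨hPm, -, hPi⟩ := mem_monicIrreducibles.1 hP
    have hiff : ∀ e : ℕ, P ^ e ∣ f ↔ e ≤ (normalizedFactors f).count P := fun e => by
      rw [pow_dvd_iff_le_emultiplicity, emultiplicity_eq_count_normalizedFactors hPi hf0,
        hPm.normalize_eq_self, Nat.cast_le]
    have hle : (normalizedFactors f).count P ≤ d := by
      have h1 := natDegree_le_of_dvd ((hiff _).2 le_rfl) hf0
      rw [hPm.natDegree_pow, hd] at h1
      exact (Nat.le_mul_of_pos_right _ hPi.natDegree_pos).trans h1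
    simp only [hiff]
    rw [← Finset.sum_filter, Finset.sum_const, smul_eq_mul]
    congr 1
    rw [show (Finset.Icc 1 d).filter (· ≤ (normalizedFactors f).count P) =
      Finset.Icc 1 ((normalizedFactors f).count P) by ext; simp; omega]
    simp
  refine (Finset.sum_congr rfl hinner).trans ((Finset.sum_subset hsub fun P _ hP => ?_).symm.trans
    hdeg)
  rw [Multiset.mem_toFinset] at hP
  rw [Multiset.count_eq_zero_of_notMem hP, zero_mul]

open Polynomial in
open Classical in
theorem sum_kloostermanWeight_of_dvd {K : Type*} [Field K] [Fintype K] (ψ : AddChar K ℂ) (c : K)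
    {P : K[X]} (hP : P.Monic) (d : ℕ) :
    ∑ f ∈ monicOfDegree K d, (if P ∣ f then kloostermanWeight ψ c f else 0) =
      if P.natDegree ≤ d then kloostermanWeight ψ c P * kloostermanCoeff ψ c (d - P.natDegree)
        else 0 := by
  split_ifs with h
  · rw [kloostermanCoeff, Finset.mul_sum, ← Finset.sum_filter]
    symm
    refine Finset.sum_bij (fun g _ => P * g) ?_ ?_ ?_ ?_
    · intro g hg
      obtain ⟨h1, h2⟩ := mem_monicOfDegree.1 hg
      exact Finset.mem_filter.2 ⟨mem_monicOfDegree.2 ⟨hP.mul h1, by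
        rw [hP.natDegree_mul h1, h2]; omega⟩, Dvd.intro _ rfl⟩
    · exact fun a _ b _ hab => mul_left_cancel₀ hP.ne_zero hab
    · intro f hf
      obtain ⟨hf, g, rfl⟩ := Finset.mem_filter.1 hf
      obtain ⟨h1, h2⟩ := mem_monicOfDegree.1 hf
      have h3 := hP.of_mul_monic_left h1
      exact ⟨g, mem_monicOfDegree.2 ⟨h3, by rw [hP.natDegree_mul h3] at h2; omega⟩, rfl⟩
    · intro g hg
      rw [kloostermanWeight_mul ψ c hP (mem_monicOfDegree.1 hg).1]
  · refine Finset.sum_eq_zero fun f hf => if_neg fun hd => h ?_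
    obtain ⟨h1, h2⟩ := mem_monicOfDegree.1 hf
    exact h2 ▸ natDegree_le_of_dvd hd h1.ne_zero

open Polynomial in
/-- The recursion equivalent to `T * L'(T) / L(T) = ∑ S_j T^j`. -/
theorem natCast_mul_kloostermanCoeff {K : Type*} [Field K] [Fintype K] (ψ : AddChar K ℂ) (c : K)
    (d : ℕ) :
    (d : ℂ) * kloostermanCoeff ψ c d = ∑ j ∈ Finset.Icc 1 d, kloostermanCoeff ψ c (d - j) *
      ∑ P ∈ monicIrreducibles K d, ∑ e ∈ Finset.Icc 1 d,
        if e * P.natDegree = j then P.natDegree * kloostermanWeight ψ c P ^ e else 0 := by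
  classical
  have h1 : (d : ℂ) * kloostermanCoeff ψ c d =
      ∑ P ∈ monicIrreducibles K d, ∑ e ∈ Finset.Icc 1 d, (P.natDegree : ℂ) *
        ∑ f ∈ monicOfDegree K d, (if P ^ e ∣ f then kloostermanWeight ψ c f else 0) := by
    rw [kloostermanCoeff, Finset.mul_sum]
    symm
    simp_rw [Finset.mul_sum]
    refine (Finset.sum_congr rfl fun P _ => Finset.sum_comm).trans ?_
    refine Finset.sum_comm.trans ?_
    refine Finset.sum_congr rfl fun f hf => ?_
    conv_rhs => rw [← sum_natDegree_of_pow_dvd hf]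
    push_cast
    rw [Finset.sum_mul]
    refine Finset.sum_congr rfl fun P _ => ?_
    rw [Finset.sum_mul]
    refine Finset.sum_congr rfl fun e _ => ?_
    split_ifs <;> simp
  rw [h1]
  simp_rw [Finset.mul_sum]
  symm
  refine Finset.sum_comm.trans (Finset.sum_congr rfl fun P hP => ?_)
  refine Finset.sum_comm.trans (Finset.sum_congr rfl fun e he => ?_)
  symm
  obtain ⟨hPm, -, hPi⟩ := mem_monicIrreducibles.1 hP
  have hpos : 1 ≤ e * P.natDegree := Nat.mul_pos (Finset.mem_Icc.1 he).1 hPi.natDegree_pos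
  rw [← Finset.mul_sum, sum_kloostermanWeight_of_dvd ψ c (hPm.pow e), hPm.natDegree_pow,
    kloostermanWeight_pow ψ c hPm]
  simp_rw [mul_ite, mul_zero]
  rw [Finset.sum_ite_eq]
  simp only [Finset.mem_Icc, hpos, true_and]
  split_ifs <;> ring

open Polynomial in
theorem kloostermanCoeff_eq_sum {K : Type*} [Field K] [Fintype K] (ψ : AddChar K ℂ) (c : K)
    (d : ℕ) : kloostermanCoeff ψ c d =
      ∑ v : Fin d → K, kloostermanWeight ψ c ((monicEquivFun K d).symm v).1 := by
  rw [kloostermanCoeff, monicOfDegree, Finset.sum_map]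
  rfl

open Polynomial in
open Classical in
theorem kloostermanWeight_monicEquivFun_symm {K : Type*} [Field K] (ψ : AddChar K ℂ)
    (c : K) (n : ℕ) (v : Fin (n + 2) → K) :
    kloostermanWeight ψ c ((monicEquivFun K (n + 2)).symm v).1 =
      if v 0 = 0 then 0 else ψ (-(v (Fin.last (n + 1)) + c * (v 1 / v 0))) := by
  have h := monicEquivFun_symm_coeff (n + 2) v
  have hd := ((monicEquivFun K (n + 2)).symm v).2.2
  rw [kloostermanWeight, nextCoeff_of_natDegree_pos (by omega), hd]
  have h0 := h 0
  have h1 := h 1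
  have h2 := h (Fin.last (n + 1))
  simp only [Fin.val_zero, Fin.val_one, Fin.val_last] at h0 h1 h2
  rw [h0, h1, show n + 2 - 1 = n + 1 by omega, h2]

open Polynomial in
theorem kloostermanCoeff_zero {K : Type*} [Field K] [Fintype K] (ψ : AddChar K ℂ) (c : K) :
    kloostermanCoeff ψ c 0 = 1 := by
  rw [kloostermanCoeff_eq_sum, Fintype.sum_unique]
  have h := ((monicEquivFun K 0).symm default).2
  rw [h.1.natDegree_eq_zero.1 h.2, kloostermanWeight_one]

theorem kloostermanCoeff_two {K : Type*} [Field K] [Fintype K] {ψ : AddChar K ℂ}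
    (hψ : ψ.IsPrimitive) {c : K} (hc : c ≠ 0) :
    kloostermanCoeff ψ c 2 = Fintype.card K := by
  classical
  rw [kloostermanCoeff_eq_sum]
  simp_rw [kloostermanWeight_monicEquivFun_symm ψ c 0]
  rw [← (finTwoArrowEquiv K).symm.sum_comp, Fintype.sum_prod_type]
  have h : ∀ a : K, ∑ b : K, (if a = 0 then (0 : ℂ) else ψ (-(b + c * (b / a)))) =
      if a = -c then (Fintype.card K : ℂ) else 0 := by
    intro a
    by_cases ha : a = 0
    · subst ha
      simp [eq_comm (a := (0 : K)), hc]
    · simp only [if_neg ha]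
      have h1 := AddChar.sum_mulShift (-(1 + c / a)) hψ
      have h2 : -(1 + c / a) = 0 ↔ a = -c := by
        rw [neg_eq_zero, add_comm, ← eq_neg_iff_add_eq_zero, div_eq_iff ha]
        constructor <;> intro h <;> linear_combination h
      rw [if_congr h2 rfl rfl] at h1
      rw [show (∑ b, ψ (-(b + c * (b / a)))) = ∑ b, ψ (b * (-(1 + c / a))) from
        Finset.sum_congr rfl fun b _ => by congr 1; ring, h1]
      split_ifs <;> simp
  calc _ = ∑ a : K, ∑ b : K, (if a = 0 then (0 : ℂ) else ψ (-(b + c * (b / a)))) := by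
        refine Finset.sum_congr rfl fun a _ => Finset.sum_congr rfl fun b _ => ?_
        rfl
    _ = _ := by rw [Finset.sum_congr rfl fun a _ => h a]; simp

theorem kloostermanCoeff_eq_zero {K : Type*} [Field K] [Fintype K] {ψ : AddChar K ℂ}
    (hψ : ψ ≠ 1) (c : K) (n : ℕ) : kloostermanCoeff ψ c (n + 3) = 0 := by
  classical
  obtain ⟨t, ht⟩ := AddChar.ne_one_iff.1 hψ
  rw [kloostermanCoeff_eq_sum]
  simp_rw [kloostermanWeight_monicEquivFun_symm ψ c (n + 1)]
  set S := ∑ v : Fin (n + 1 + 2) → K,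
    (if v 0 = 0 then 0 else ψ (-(v (Fin.last (n + 1 + 1)) + c * (v 1 / v 0)))) with hS
  have h : S = ψ t * S := by
    rw [hS, Finset.mul_sum]
    refine (Equiv.sum_comp
      (Equiv.addRight (Pi.single (Fin.last (n + 1 + 1)) (-t) : Fin (n + 1 + 2) → K)) _).symm.trans
        ?_
    refine Finset.sum_congr rfl fun v _ => ?_
    have h0 : (0 : Fin (n + 1 + 2)) ≠ Fin.last (n + 1 + 1) := by simp [Fin.ext_iff]
    have h1 : (1 : Fin (n + 1 + 2)) ≠ Fin.last (n + 1 + 1) := by simp [Fin.ext_iff]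
    simp only [Equiv.coe_addRight, Pi.add_apply, Pi.single_eq_same, Pi.single_eq_of_ne h0,
      Pi.single_eq_of_ne h1, add_zero, mul_ite, mul_zero, ← AddChar.map_add_eq_mul]
    split_ifs
    · rfl
    · congr 1; ring
  have h2 : (ψ t - 1) * S = 0 := by linear_combination -h
  exact (mul_eq_zero.1 h2).resolve_left (sub_ne_zero.2 ht)

open Polynomial IntermediateField in
theorem minpoly_inv_nextCoeff {K L : Type*} [Field K] [Field L] [Algebra K L]
    [FiniteDimensional K L] {x : L} (hx : x ≠ 0) :
    (minpoly K x⁻¹).nextCoeff = (minpoly K x).coeff 1 / (minpoly K x).coeff 0 := by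
  have hint := IsIntegral.of_finite K x
  have hinti := IsIntegral.of_finite K x⁻¹
  have hadj : K⟮x⁻¹⟯ = K⟮x⟯ := by
    apply le_antisymm
    · exact adjoin_simple_le_iff.2 (inv_mem (mem_adjoin_simple_self K x))
    · refine adjoin_simple_le_iff.2 ?_
      simpa using inv_mem (mem_adjoin_simple_self K x⁻¹)
  have hdeg : (minpoly K x⁻¹).natDegree = (minpoly K x).natDegree := by
    rw [← adjoin.finrank hint, ← adjoin.finrank hinti, hadj]
  have h0 : (minpoly K x).coeff 0 ≠ 0 := minpoly.coeff_zero_ne_zero hint hx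
  set f := minpoly K x with hf
  have hfm : f.Monic := minpoly.monic hint
  have hev : aeval x⁻¹ f.reverse = 0 := by
    let _ := invertibleOfNonzero hx
    have := (eval₂_reverse_eq_zero_iff (algebraMap K L) x f).2 (minpoly.aeval K x)
    rwa [invOf_eq_inv] at this
  have htd : f.natTrailingDegree = 0 := natTrailingDegree_eq_zero.2 (Or.inr h0)
  have hrd : f.reverse.natDegree = f.natDegree := by
    rw [reverse_natDegree, htd, Nat.sub_zero]
  have hlc : f.reverse.leadingCoeff = f.coeff 0 := by
    rw [reverse_leadingCoeff, trailingCoeff,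
      htd]
  have hmon : (C (f.coeff 0)⁻¹ * f.reverse).Monic := by
    rw [Monic, leadingCoeff_mul, leadingCoeff_C, hlc, inv_mul_cancel₀ h0]
  have hdvd : minpoly K x⁻¹ ∣ C (f.coeff 0)⁻¹ * f.reverse :=
    minpoly.dvd K _ (by rw [map_mul, hev, mul_zero])
  have heq := eq_of_monic_of_dvd_of_natDegree_le (minpoly.monic hinti) hmon hdvd (by
    rw [natDegree_C_mul (inv_ne_zero h0), hrd, hdeg])
  have hpos : 0 < f.natDegree := minpoly.natDegree_pos hint
  rw [← heq, nextCoeff_of_natDegree_pos (by rw [natDegree_C_mul (inv_ne_zero h0), hrd]; exact hpos),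
    natDegree_C_mul (inv_ne_zero h0), hrd, coeff_C_mul, coeff_reverse,
    revAt_le (by omega), show f.natDegree - (f.natDegree - 1) = 1 by omega]
  ring

open Polynomial IntermediateField in
theorem addChar_trace_eq_kloostermanWeight {K L : Type*} [Field K] [Field L] [Algebra K L]
    [FiniteDimensional K L] (ψ : AddChar K ℂ) (c : K) {x : L} (hx : x ≠ 0) {e : ℕ}
    (he : e * (minpoly K x).natDegree = Module.finrank K L) :
    ψ (Algebra.trace K L (x + algebraMap K L c * x⁻¹)) =
      kloostermanWeight ψ c (minpoly K x) ^ e := by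
  have hint := IsIntegral.of_finite K x
  have hadj : K⟮x⁻¹⟯ = K⟮x⟯ := by
    apply le_antisymm
    · exact adjoin_simple_le_iff.2 (inv_mem (mem_adjoin_simple_self K x))
    · refine adjoin_simple_le_iff.2 ?_
      simpa using inv_mem (mem_adjoin_simple_self K x⁻¹)
  have hfin : Module.finrank K⟮x⟯ L = e := by
    have h1 := Module.finrank_mul_finrank K K⟮x⟯ L
    rw [adjoin.finrank hint, ← he, mul_comm] at h1
    exact Nat.eq_of_mul_eq_mul_right (minpoly.natDegree_pos hint) h1
  have hfin' : Module.finrank K⟮x⁻¹⟯ L = e :=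
    (congrArg (fun E : IntermediateField K L => Module.finrank E L) hadj).trans hfin
  rw [kloostermanWeight, if_neg (minpoly.coeff_zero_ne_zero hint hx), ← AddChar.map_nsmul_eq_pow,
    map_add, ← Algebra.smul_def, map_smul, trace_eq_finrank_mul_minpoly_nextCoeff,
    trace_eq_finrank_mul_minpoly_nextCoeff K x⁻¹, hfin, hfin', minpoly_inv_nextCoeff hx]
  congr 1
  simp only [smul_eq_mul, nsmul_eq_mul]
  ring

open Polynomial in
theorem card_minpoly_eq {K L : Type*} [Field K] [Finite K] [Field L] [Fintype L] [DecidableEq K[X]]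
    [Algebra K L] {P : K[X]} (hP : P.Monic) (hPi : Irreducible P)
    (hd : P.natDegree ∣ Module.finrank K L) :
    (Finset.univ.filter fun x : L => minpoly K x = P).card = P.natDegree := by
  classical
  have hcard : Nat.card K ^ Module.finrank K L = Fintype.card L := by
    rw [← Nat.card_eq_fintype_card, Module.natCard_eq_pow_finrank (K := K) (V := L)]
  have hsplit : (P.map (algebraMap K L)).Splits := by
    have h1 := hPi.natDegree_dvd_iff_dvd_X_pow_card_pow_sub_X.1 hd
    rw [hcard] at h1
    refine Splits.of_dvd (FiniteField.isSplittingField_sub L K).splits ?_ (Polynomial.map_dvd _ h1)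
    exact Polynomial.map_ne_zero (FiniteField.X_pow_card_sub_X_ne_zero K Fintype.one_lt_card)
  rw [← card_rootSet_eq_natDegree (PerfectField.separable_of_irreducible hPi) hsplit,
    ← Set.toFinset_card]
  congr 1
  ext x
  simp only [Finset.mem_filter, Finset.mem_univ, true_and, Set.mem_toFinset,
    mem_rootSet, ne_eq, hP.ne_zero, not_false_eq_true]
  constructor
  · rintro rfl
    exact minpoly.aeval K x
  · exact fun h => (minpoly.eq_of_irreducible_of_monic hPi h hP).symm

open Polynomial in
open Classical in
/-- The Kloosterman sum over a finite extension as a sum over irreducible polynomials. -/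
theorem sum_addChar_trace_eq {K L : Type*} [Field K] [Fintype K] [Field L] [Fintype L]
    [Algebra K L] (ψ : AddChar K ℂ) (c : K) {d : ℕ} (hd : Module.finrank K L ≤ d) :
    ∑ x : L, (if x = 0 then 0 else ψ (Algebra.trace K L (x + algebraMap K L c * x⁻¹))) =
      ∑ P ∈ monicIrreducibles K d, ∑ e ∈ Finset.Icc 1 d,
        if e * P.natDegree = Module.finrank K L then
          (P.natDegree : ℂ) * kloostermanWeight ψ c P ^ e else 0 := by
  have hfpos : 0 < Module.finrank K L := Module.finrank_pos
  have hmem : ∀ x : L, minpoly K x ∈ monicIrreducibles K d := fun x => by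
    have hint := IsIntegral.of_finite K x
    exact mem_monicIrreducibles.2 ⟨minpoly.monic hint,
      (Nat.le_of_dvd hfpos (minpoly.degree_dvd hint)).trans hd, minpoly.irreducible hint⟩
  rw [← Finset.sum_fiberwise_of_maps_to (s := Finset.univ) (t := monicIrreducibles K d)
    (g := fun x : L => minpoly K x) (fun x _ => hmem x)]
  refine Finset.sum_congr rfl fun P hP => ?_
  obtain ⟨hPm, -, hPi⟩ := mem_monicIrreducibles.1 hP
  by_cases hdvd : P.natDegree ∣ Module.finrank K L
  · obtain ⟨e, he⟩ := hdvd
    rw [mul_comm] at he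
    have hePos : 0 < e := Nat.pos_of_ne_zero (by rintro rfl; omega)
    have hele : e ≤ d := (Nat.le_mul_of_pos_right e hPi.natDegree_pos).trans (he ▸ hd)
    have h1 : ∀ e' : ℕ, e' * P.natDegree = Module.finrank K L ↔ e' = e := fun e' => by
      rw [he]
      exact ⟨fun h => Nat.eq_of_mul_eq_mul_right hPi.natDegree_pos h, fun h => h ▸ rfl⟩
    simp only [h1]
    rw [Finset.sum_ite_eq', if_pos (Finset.mem_Icc.2 ⟨hePos, hele⟩)]
    rw [← card_minpoly_eq (L := L) hPm hPi ⟨e, by rw [he, mul_comm]⟩, ← nsmul_eq_mul,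
      ← Finset.sum_const]
    refine Finset.sum_congr rfl fun x hx => ?_
    have hx' : minpoly K x = P := (Finset.mem_filter.1 hx).2
    by_cases hx0 : x = 0
    · subst hx0
      rw [if_pos rfl, ← hx', minpoly.zero, kloostermanWeight, if_pos coeff_X_zero,
        zero_pow hePos.ne']
    · rw [if_neg hx0, addChar_trace_eq_kloostermanWeight ψ c hx0 (by rw [hx', he]), hx']
  · rw [Finset.sum_eq_zero, Finset.sum_eq_zero]
    · intro e _
      exact if_neg fun h => hdvd (Dvd.intro_left _ h)
    · intro x hx
      exact absurd ((Finset.mem_filter.1 hx).2 ▸ minpoly.degree_dvd (IsIntegral.of_finite K x)) hdvd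

/-- The Kloosterman sum `∑ x, ψ (Tr (x + c / x))` over a finite extension `L` of `K`. -/
noncomputable def kloostermanTraceSum {K : Type*} (L : Type*) [Field K] [Field L] [Finite L]
    [Algebra K L] (ψ : AddChar K ℂ) (c : K) : ℂ :=
  open Classical in
  letI := Fintype.ofFinite L
  ∑ x : L, if x = 0 then 0 else ψ (Algebra.trace K L (x + algebraMap K L c * x⁻¹))

open Polynomial in
open Classical in
theorem kloostermanTraceSum_eq {K L : Type*} [Field K] [Fintype K] [Field L] [Finite L]
    [Algebra K L] (ψ : AddChar K ℂ) (c : K) {d : ℕ} (hd : Module.finrank K L ≤ d) :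
    kloostermanTraceSum L ψ c = ∑ P ∈ monicIrreducibles K d, ∑ e ∈ Finset.Icc 1 d,
        if e * P.natDegree = Module.finrank K L then
          (P.natDegree : ℂ) * kloostermanWeight ψ c P ^ e else 0 :=
  letI := Fintype.ofFinite L
  sum_addChar_trace_eq ψ c hd

section GaloisField

variable (p : ℕ) [Fact p.Prime]

theorem natCast_mul_kloostermanCoeff_eq_sum (ψ : AddChar (ZMod p) ℂ) (c : ZMod p) (d : ℕ) :
    (d : ℂ) * kloostermanCoeff ψ c d = ∑ j ∈ Finset.Icc 1 d,
      kloostermanCoeff ψ c (d - j) * kloostermanTraceSum (GaloisField p j) ψ c := by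
  classical
  rw [natCast_mul_kloostermanCoeff]
  refine Finset.sum_congr rfl fun j hj => ?_
  obtain ⟨h1, h2⟩ := Finset.mem_Icc.1 hj
  have hf : Module.finrank (ZMod p) (GaloisField p j) = j := GaloisField.finrank p (by omega)
  rw [kloostermanTraceSum_eq ψ c (hf.le.trans h2), hf]

theorem kloostermanTraceSum_two {ψ : AddChar (ZMod p) ℂ} (hψ : ψ.IsPrimitive) {c : ZMod p}
    (hc : c ≠ 0) : kloostermanTraceSum (GaloisField p 2) ψ c =
      2 * p - kloostermanTraceSum (GaloisField p 1) ψ c ^ 2 := by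
  have h1 := natCast_mul_kloostermanCoeff_eq_sum p ψ c 1
  have h2 := natCast_mul_kloostermanCoeff_eq_sum p ψ c 2
  rw [kloostermanCoeff_two hψ hc, ZMod.card] at h2
  rw [Finset.sum_Icc_succ_top (by norm_num)] at h2
  simp [kloostermanCoeff_zero] at h1 h2
  rw [h1] at h2
  linear_combination -h2

theorem kloostermanTraceSum_add_three {ψ : AddChar (ZMod p) ℂ} (hψ : ψ.IsPrimitive)
    {c : ZMod p} (hc : c ≠ 0) (n : ℕ) : kloostermanTraceSum (GaloisField p (n + 3)) ψ c =
      -(kloostermanTraceSum (GaloisField p 1) ψ c * kloostermanTraceSum (GaloisField p (n + 2)) ψ c)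
        - p * kloostermanTraceSum (GaloisField p (n + 1)) ψ c := by
  have hψ1 : ψ ≠ 1 := by simpa using hψ one_ne_zero
  have h1 := natCast_mul_kloostermanCoeff_eq_sum p ψ c 1
  have h2 := natCast_mul_kloostermanCoeff_eq_sum p ψ c (n + 3)
  rw [kloostermanCoeff_eq_zero hψ1, Finset.sum_Icc_succ_top (by omega),
    Finset.sum_Icc_succ_top (by omega), Finset.sum_Icc_succ_top (by omega), Finset.sum_eq_zero,
    show n + 2 + 1 - (n + 2) = 1 by omega, show n + 2 + 1 - (n + 1) = 2 by omega,
    kloostermanCoeff_two hψ hc, ZMod.card, Nat.sub_self, kloostermanCoeff_zero] at h2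
  · simp [kloostermanCoeff_zero] at h1
    rw [h1] at h2
    linear_combination -h2
  · intro j hj
    obtain ⟨hj1, hj2⟩ := Finset.mem_Icc.1 hj
    rw [show n + 2 + 1 - j = (n - j) + 3 by omega, kloostermanCoeff_eq_zero hψ1, zero_mul]

theorem exists_kloostermanTraceSum_eq {ψ : AddChar (ZMod p) ℂ} (hψ : ψ.IsPrimitive)
    {c : ZMod p} (hc : c ≠ 0) : ∃ α β : ℂ, α * β = p ∧
      ∀ n, kloostermanTraceSum (GaloisField p (n + 1)) ψ c = -(α ^ (n + 1) + β ^ (n + 1)) := by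
  set s := kloostermanTraceSum (GaloisField p 1) ψ c with hs
  obtain ⟨w, hw⟩ := IsAlgClosed.exists_pow_nat_eq (s ^ 2 - 4 * p) (n := 2) (by norm_num)
  refine ⟨(-s + w) / 2, (-s - w) / 2, by linear_combination -hw / 4, ?_⟩
  set α := (-s + w) / 2 with hα
  set β := (-s - w) / 2 with hβ
  have hsum : α + β = -s := by rw [hα, hβ]; ring
  have hprod : α * β = p := by rw [hα, hβ]; linear_combination -hw / 4
  have key : ∀ n, kloostermanTraceSum (GaloisField p (n + 1)) ψ c = -(α ^ (n + 1) + β ^ (n + 1)) ∧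
      kloostermanTraceSum (GaloisField p (n + 2)) ψ c = -(α ^ (n + 2) + β ^ (n + 2)) := by
    intro n
    induction n with
    | zero =>
      refine ⟨by simp only [zero_add, ← hs]; linear_combination -hsum, ?_⟩
      rw [zero_add, kloostermanTraceSum_two p hψ hc, ← hs]
      linear_combination -2 * hprod + (α + β - s) * hsum
    | succ n ih =>
      refine ⟨ih.2, ?_⟩
      rw [show n + 1 + 2 = n + 3 by omega, kloostermanTraceSum_add_three p hψ hc, ih.1, ih.2, ← hs]
      linear_combination (α ^ (n + 2) + β ^ (n + 2)) * hsum - (α ^ (n + 1) + β ^ (n + 1)) * hprod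
  exact fun n => (key n).1

end GaloisField

theorem norm_le_of_norm_pow_add_pow_le {α β : ℂ} {p C : ℝ} (hp : 0 < p) (hαβ : ‖α * β‖ = p ^ 2)
    (h : ∀ n : ℕ, ‖α ^ (n + 1) + β ^ (n + 1)‖ ≤ C * p ^ (n + 1)) : ‖α‖ ≤ p := by
  by_contra! hlt
  have hβ : ‖β‖ ≤ p := by
    by_contra! hβ
    rw [norm_mul] at hαβ
    nlinarith
  obtain ⟨n, hn⟩ := pow_unbounded_of_one_lt (C + 1) ((one_lt_div hp).2 hlt)
  have h1 : ‖α‖ ^ (n + 1) ≤ (C + 1) * p ^ (n + 1) := by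
    calc ‖α‖ ^ (n + 1) = ‖(α ^ (n + 1) + β ^ (n + 1)) - β ^ (n + 1)‖ := by
          rw [add_sub_cancel_right, norm_pow]
      _ ≤ ‖α ^ (n + 1) + β ^ (n + 1)‖ + ‖β‖ ^ (n + 1) := by
          rw [← norm_pow]; exact norm_sub_le _ _
      _ ≤ C * p ^ (n + 1) + p ^ (n + 1) := add_le_add (h n) (by gcongr)
      _ = _ := by ring
  have h2 : (‖α‖ / p) ^ (n + 1) ≤ C + 1 := by
    rw [div_pow, div_le_iff₀ (by positivity)]; exact h1
  have h3 : (‖α‖ / p) ^ n ≤ (‖α‖ / p) ^ (n + 1) :=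
    pow_le_pow_right₀ ((one_lt_div hp).2 hlt).le (by omega)
  linarith

theorem norm_sum_addChar_le {K ι : Type*} [Field K] [Fintype K] [DecidableEq K] {ψ : AddChar K ℂ}
    (hψ : ψ ≠ 1) (s : Finset ι) (T : ι → K) (M : ℕ)
    (h : ∀ t, (s.filter fun x => T x = t).card ≤ M) :
    ‖∑ x ∈ s, ψ (T x)‖ ≤ Fintype.card K * M - s.card := by
  have h1 : ∑ x ∈ s, ψ (T x) = ∑ t, (((s.filter fun x => T x = t).card : ℂ) - M) * ψ t := by
    simp_rw [sub_mul]
    rw [Finset.sum_sub_distrib, ← Finset.mul_sum, AddChar.sum_eq_zero_of_ne_one hψ, mul_zero,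
      sub_zero, ← Finset.sum_fiberwise s T]
    refine Finset.sum_congr rfl fun t _ => ?_
    rw [← nsmul_eq_mul, ← Finset.sum_const]
    exact Finset.sum_congr rfl fun x hx => by rw [(Finset.mem_filter.1 hx).2]
  have h2 : (s.card : ℝ) = ∑ t, ((s.filter fun x => T x = t).card : ℝ) := by
    exact_mod_cast Finset.card_eq_sum_card_fiberwise (t := Finset.univ) fun _ _ => by simp
  rw [h1, h2]
  refine (norm_sum_le _ _).trans (le_of_eq ?_)
  rw [← nsmul_eq_mul, ← Finset.card_univ, ← Finset.sum_const, ← Finset.sum_sub_distrib]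
  refine Finset.sum_congr rfl fun t _ => ?_
  rw [norm_mul, ψ.norm_apply, mul_one, norm_sub_rev]
  have h3 : ((M : ℂ) - ((s.filter fun x => T x = t).card : ℂ)) =
      ((M - (s.filter fun x => T x = t).card : ℝ) : ℂ) := by push_cast; rfl
  rw [h3, Complex.norm_real, Real.norm_of_nonneg]
  rw [sub_nonneg]
  exact_mod_cast h t

theorem norm_kloostermanTraceSum_even_le (p : ℕ) [Fact p.Prime] {ψ : AddChar (ZMod p) ℂ}
    (hψ : ψ ≠ 1) (c : ZMod p) (r : ℕ) :
    ‖kloostermanTraceSum (GaloisField p (2 * r + 2)) ψ c‖ ≤ (7 * p + 1) * p ^ (r + 1) := by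
  classical
  have hp : 1 ≤ p := (Fact.out : p.Prime).one_lt.le
  set L := GaloisField p (2 * r + 2)
  let _ := Fintype.ofFinite L
  have hcard : Fintype.card L = p ^ (2 * r + 2) := by
    rw [← Nat.card_eq_fintype_card]; exact GaloisField.card p _ (by omega)
  have hf : Module.finrank (ZMod p) L = 2 * r + 2 := GaloisField.finrank p (by omega)
  set T : L → ZMod p := fun x => Algebra.trace (ZMod p) L (x + algebraMap (ZMod p) L c * x⁻¹)
    with hT
  have hsum : kloostermanTraceSum L ψ c = ∑ x ∈ Finset.univ.erase 0, ψ (T x) := by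
    rw [← Finset.filter_ne', Finset.sum_filter]
    refine Finset.sum_congr (by ext; simp) fun x _ => ?_
    simp only [ne_eq, ite_not]
    congr
  have hM : ∀ t, ((Finset.univ.erase 0).filter fun x => T x = t).card ≤
      p ^ (r + 1) * (p ^ r + 7) := by
    intro t
    refine card_le_of_trace_eq p r (algebraMap (ZMod p) L c) (algebraMap (ZMod p) L t) _
      fun x hx => ?_
    simp only [Finset.mem_filter, Finset.mem_erase, Finset.mem_univ, and_true] at hx
    refine ⟨hx.1, by rw [← hcard]; exact FiniteField.pow_card x, ?_⟩
    rw [← hx.2, hT, FiniteField.algebraMap_trace_eq_sum_pow, hf, Nat.card_zmod]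
    refine Finset.sum_congr rfl fun i _ => ?_
    rw [add_pow_char_pow, mul_pow]
  rw [hsum]
  refine (norm_sum_addChar_le hψ _ T _ hM).trans (le_of_eq_of_le ?_ (?_ :
    (7 * p : ℝ) * p ^ (r + 1) + 1 ≤ _))
  · rw [Finset.card_erase_of_mem (Finset.mem_univ _), Finset.card_univ, hcard, ZMod.card,
      Nat.cast_sub (Nat.one_le_pow _ _ hp)]
    push_cast
    ring
  · have : (1 : ℝ) ≤ (p : ℝ) ^ (r + 1) := one_le_pow₀ (by exact_mod_cast hp)
    linarith

/-- Weil's bound for Kloosterman sums to a prime modulus. -/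
theorem norm_sum_addChar_add_mul_inv_le (p : ℕ) [Fact p.Prime] {ψ : AddChar (ZMod p) ℂ}
    (hψ : ψ ≠ 1) {c : ZMod p} (hc : c ≠ 0) :
    ‖∑ x ∈ Finset.univ.erase 0, ψ (x + c * x⁻¹)‖ ≤ 2 * √p := by
  classical
  have hp : (0 : ℝ) < p := by exact_mod_cast (Fact.out : p.Prime).pos
  have hsum : kloostermanTraceSum (GaloisField p 1) ψ c =
      ∑ x ∈ Finset.univ.erase 0, ψ (x + c * x⁻¹) := by
    trans kloostermanTraceSum (ZMod p) ψ c
    · have h1 : Module.finrank (ZMod p) (GaloisField p 1) = 1 := GaloisField.finrank p one_ne_zero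
      have h2 : Module.finrank (ZMod p) (ZMod p) = 1 := Module.finrank_self _
      rw [kloostermanTraceSum_eq ψ c h1.le, kloostermanTraceSum_eq ψ c h2.le, h1, h2]
    · rw [← Finset.filter_ne', Finset.sum_filter]
      refine Finset.sum_congr (by ext; simp) fun x _ => ?_
      simp only [ne_eq, ite_not, Algebra.trace_self_apply, Algebra.algebraMap_self,
        RingHom.id_apply]
  obtain ⟨α, β, hαβ, h⟩ := exists_kloostermanTraceSum_eq p (.of_ne_one hψ) hc
  have hbound : ∀ n : ℕ, ‖(α ^ 2) ^ (n + 1) + (β ^ 2) ^ (n + 1)‖ ≤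
      (7 * p + 1) * (p : ℝ) ^ (n + 1) := by
    intro n
    have := norm_kloostermanTraceSum_even_le p hψ c n
    rw [h (2 * n + 1), norm_neg] at this
    rwa [← pow_mul, ← pow_mul]
  have hprod : ‖α ^ 2 * β ^ 2‖ = (p : ℝ) ^ 2 := by
    rw [← mul_pow, hαβ, norm_pow, Complex.norm_natCast]
  have hα : ‖α‖ ≤ √p := by
    refine Real.le_sqrt_of_sq_le ?_
    rw [← norm_pow]
    exact norm_le_of_norm_pow_add_pow_le hp hprod hbound
  have hβ : ‖β‖ ≤ √p := by
    refine Real.le_sqrt_of_sq_le ?_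
    rw [← norm_pow]
    refine norm_le_of_norm_pow_add_pow_le (C := 7 * p + 1) hp (by rwa [mul_comm] at hprod) fun n =>
      ?_
    rw [add_comm]
    exact hbound n
  rw [← hsum, h 0, norm_neg, zero_add, pow_one, pow_one]
  linarith [norm_add_le α β]

/-- The absolute value of a quadratic exponential sum over a finite ring. -/
theorem norm_sq_sum_addChar_quadratic {R : Type*} [CommRing R] [Fintype R]
    [DecidableEq R] {ψ : AddChar R ℂ} (hψ : ψ.IsPrimitive)
    (s t : R) : ((‖∑ z, ψ (s * z + t * z ^ 2)‖ ^ 2 : ℝ) : ℂ) =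
      Fintype.card R * ∑ h : R with 2 * t * h = 0, ψ (s * h + t * h ^ 2) := by
  rw [Complex.ofReal_pow, ← Complex.mul_conj', map_sum]
  have hconj : ∀ x : R, (starRingEnd ℂ) (ψ x) = ψ (-x) := fun x => by
    rw [AddChar.map_neg_eq_conj]
  simp_rw [hconj]
  rw [Finset.sum_mul_sum, Finset.sum_comm]
  calc _ = ∑ z, ∑ h, ψ (s * h + t * h ^ 2) * ψ (z * (2 * t * h)) := by
        refine Finset.sum_congr rfl fun z _ => ?_
        refine (Equiv.sum_comp (Equiv.addRight z) _).symm.trans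
          (Finset.sum_congr rfl fun h _ => ?_)
        rw [Equiv.coe_addRight, ← AddChar.map_add_eq_mul, ← AddChar.map_add_eq_mul]
        congr 1
        ring
    _ = _ := by
        rw [Finset.sum_comm, Finset.mul_sum, Finset.sum_filter]
        refine Finset.sum_congr rfl fun h _ => ?_
        rw [← Finset.mul_sum, AddChar.sum_mulShift _ hψ]
        split_ifs
        · ring
        · simp

section FiniteRing

variable {R : Type*} [CommRing R] [Fintype Rˣ]

/-- The Kloosterman sum of an additive character `ψ` of a finite ring. -/
noncomputable def kloostermanSum (ψ : AddChar R ℂ) (m n : R) : ℂ :=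
  ∑ u : Rˣ, ψ (m * u + n * (u⁻¹ : Rˣ))

theorem kloostermanSum_comm (ψ : AddChar R ℂ) (m n : R) :
    kloostermanSum ψ m n = kloostermanSum ψ n m := by
  refine Fintype.sum_equiv (Equiv.inv Rˣ) _ _ fun u => ?_
  rw [Equiv.inv_apply, inv_inv, add_comm]

theorem kloostermanSum_unit_mul (ψ : AddChar R ℂ) (v : Rˣ) (m n : R) :
    kloostermanSum ψ (v * m) n = kloostermanSum ψ m (v * n) := by
  refine Fintype.sum_equiv (Equiv.mulRight v) _ _ fun u => ?_
  rw [Equiv.coe_mulRight, mul_inv]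
  congr 1
  push_cast
  linear_combination -n * (u⁻¹ : Rˣ) * v.mul_inv

variable [Fintype R]

theorem norm_kloostermanSum_le_card (ψ : AddChar R ℂ) (m n : R) :
    ‖kloostermanSum ψ m n‖ ≤ Fintype.card Rˣ := by
  refine (norm_sum_le _ _).trans (le_of_eq ?_)
  simp [ψ.norm_apply]

/-- Averaging the summand of a Kloosterman sum over the cosets of the units `1 + e * z`. -/
theorem card_mul_kloostermanSum_eq (ψ : AddChar R ℂ) (m n : R) {e : R} (he : e ^ 3 = 0) :
    Fintype.card R * kloostermanSum ψ m n = ∑ u : Rˣ, ψ (m * u + n * (u⁻¹ : Rˣ)) *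
      ∑ z : R, ψ (e * z * (m * u - n * (u⁻¹ : Rˣ)) + e ^ 2 * z ^ 2 * (n * (u⁻¹ : Rˣ))) := by
  let w : R → Rˣ := fun z => ⟨1 + e * z, 1 - e * z + e ^ 2 * z ^ 2,
    by linear_combination z ^ 3 * he, by linear_combination z ^ 3 * he⟩
  have h : ∀ z : R, kloostermanSum ψ m n = ∑ u : Rˣ, ψ (m * u + n * (u⁻¹ : Rˣ)) *
      ψ (e * z * (m * u - n * (u⁻¹ : Rˣ)) + e ^ 2 * z ^ 2 * (n * (u⁻¹ : Rˣ))) := by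
    intro z
    refine (Equiv.sum_comp (Equiv.mulRight (w z)) _).symm.trans (Finset.sum_congr rfl fun u _ => ?_)
    rw [Equiv.coe_mulRight, mul_inv, ← AddChar.map_add_eq_mul]
    congr 1
    push_cast
    rw [show ((w z : Rˣ) : R) = 1 + e * z from rfl,
      show (((w z)⁻¹ : Rˣ) : R) = 1 - e * z + e ^ 2 * z ^ 2 from rfl]
    ring
  simp_rw [Finset.mul_sum]
  rw [Finset.sum_comm, ← nsmul_eq_mul, ← Finset.card_univ, ← Finset.sum_const]
  exact Finset.sum_congr rfl fun z _ => h z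

theorem kloostermanSum_eq_sum_filter [DecidableEq R] {ψ : AddChar R ℂ} (hψ : ψ.IsPrimitive)
    (m n : R) {e : R}
    (he : e ^ 2 = 0) : kloostermanSum ψ m n =
      ∑ u : Rˣ with e * (m * u - n * (u⁻¹ : Rˣ)) = 0, ψ (m * u + n * (u⁻¹ : Rˣ)) := by
  have h := card_mul_kloostermanSum_eq ψ m n (e := e) (by rw [pow_succ, he, zero_mul])
  have hc : (Fintype.card R : ℂ) ≠ 0 := by
    exact_mod_cast Fintype.card_ne_zero
  refine mul_left_cancel₀ hc (h.trans ?_)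
  rw [Finset.mul_sum, Finset.sum_filter]
  refine Finset.sum_congr rfl fun u _ => ?_
  have h1 := AddChar.sum_mulShift (e * (m * u - n * (u⁻¹ : Rˣ))) hψ
  rw [Finset.sum_congr rfl fun z _ => congrArg ψ (show e * z * (m * u - n * (u⁻¹ : Rˣ)) +
    e ^ 2 * z ^ 2 * (n * (u⁻¹ : Rˣ)) = z * (e * (m * u - n * (u⁻¹ : Rˣ))) by rw [he]; ring), h1]
  split_ifs
  · ring
  · simp

end FiniteRing

theorem norm_kloostermanSum_prime_le (p : ℕ) [Fact p.Prime] (m n : ℤ) :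
    ‖kloostermanSum (ZMod.stdAddChar (N := p)) m n‖ ≤
      2 * √p * √(Nat.gcd (Int.gcd m n) p) := by
  have hp : p.Prime := Fact.out
  have hp1 : (1 : ℝ) ≤ √p := Real.one_le_sqrt.2 (by exact_mod_cast hp.one_lt.le)
  have hg : (1 : ℝ) ≤ √(Nat.gcd (Int.gcd m n) p) :=
    Real.one_le_sqrt.2 (by exact_mod_cast Nat.gcd_pos_of_pos_right _ hp.pos)
  set ψ := ZMod.stdAddChar (N := p)
  have hψ : ψ.IsPrimitive := ZMod.isPrimitive_stdAddChar p
  have hψ1 : ψ ≠ 1 := by simpa using hψ one_ne_zero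
  have hunits : ∀ f : ZMod p → ℂ, ∑ u : (ZMod p)ˣ, f u = ∑ x ∈ Finset.univ.erase 0, f x := by
    intro f
    refine Finset.sum_bij' (fun u _ => (u : ZMod p))
      (fun x hx => Units.mk0 x (Finset.ne_of_mem_erase hx)) ?_ ?_ ?_ ?_ ?_ <;> simp
  have hone : ∀ n : ZMod p, n ≠ 0 → ‖kloostermanSum ψ n 0‖ ≤ 1 := by
    intro n hn
    have h1 := kloostermanSum_unit_mul ψ (Units.mk0 n hn) 1 0
    rw [Units.val_mk0, mul_one, mul_zero] at h1
    rw [h1, kloostermanSum]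
    simp only [one_mul, zero_mul, add_zero]
    rw [hunits fun x => ψ x, Finset.sum_erase_eq_sub (Finset.mem_univ _),
      AddChar.sum_eq_zero_of_ne_one hψ1]
    simp
  by_cases hm : (m : ZMod p) = 0
  · by_cases hn : (n : ZMod p) = 0
    · have hgcd : Nat.gcd (Int.gcd m n) p = p := by
        refine Nat.gcd_eq_right ?_
        rw [ZMod.intCast_zmod_eq_zero_iff_dvd] at hm hn
        exact_mod_cast Int.dvd_coe_gcd hm hn
      rw [hgcd, mul_assoc, Real.mul_self_sqrt (by positivity)]
      refine (norm_kloostermanSum_le_card _ _ _).trans ?_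
      have : (Fintype.card (ZMod p)ˣ : ℝ) ≤ p := by
        rw [ZMod.card_units_eq_totient]; exact_mod_cast Nat.totient_le p
      have : (0 : ℝ) ≤ p := by positivity
      linarith
    · rw [hm, kloostermanSum_comm]
      exact (hone _ hn).trans (by nlinarith)
  · by_cases hn : (n : ZMod p) = 0
    · rw [hn]
      exact (hone _ hm).trans (by nlinarith)
    · have h1 := kloostermanSum_unit_mul ψ (Units.mk0 (m : ZMod p) hm) 1 n
      rw [Units.val_mk0, mul_one] at h1
      have h2 := norm_sum_addChar_add_mul_inv_le p hψ1 (mul_ne_zero hm hn)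
      rw [h1, kloostermanSum]
      simp only [one_mul, Units.val_inv_eq_inv_val]
      rw [hunits fun x => ψ (x + m * n * x⁻¹)]
      exact h2.trans (le_mul_of_one_le_right (by positivity) hg)

theorem card_mul_sum_comp_monoidHom {G H : Type*} [Group G] [Group H] [Fintype G] [Fintype H]
    {φ : G →* H} (hφ : Function.Surjective φ) (f : H → ℂ) :
    Fintype.card H * ∑ g, f (φ g) = Fintype.card G * ∑ h, f h := by
  have h1 : ∀ h : H, ∑ g, f (φ g * h) = ∑ g, f (φ g) := by
    intro h
    obtain ⟨g₀, rfl⟩ := hφ h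
    simp_rw [← map_mul]
    exact Equiv.sum_comp (Equiv.mulRight g₀) fun g => f (φ g)
  calc _ = ∑ h : H, ∑ g, f (φ g * h) := by
        rw [Finset.sum_congr rfl fun h _ => h1 h, Finset.sum_const, Finset.card_univ, nsmul_eq_mul]
    _ = ∑ g : G, ∑ h, f h := by
        rw [Finset.sum_comm]
        exact Finset.sum_congr rfl fun g _ => Equiv.sum_comp (Equiv.mulLeft (φ g)) f
    _ = _ := by rw [Finset.sum_const, Finset.card_univ, nsmul_eq_mul]

theorem ZMod.card_natCast_mul_sub_eq_zero_le {N : ℕ} [NeZero N] {c : ℕ} (hc : 0 < c) (y : ZMod N) :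
    (Finset.univ.filter fun x : ZMod N => (c : ZMod N) * (x - y) = 0).card ≤ c := by
  refine le_trans (Finset.card_le_card_of_injOn (fun x => x - y) ?_ ?_)
    (IsAddCyclic.card_nsmul_eq_zero_le (α := ZMod N) hc)
  · intro x hx
    simpa using hx
  · intro x _ x' _ h
    exact sub_left_injective h

theorem ZMod.natCast_pow_eq_zero {p k j : ℕ} (h : k ≤ j) : (p : ZMod (p ^ k)) ^ j = 0 := by
  rw [← Nat.cast_pow, ZMod.natCast_eq_zero_iff]
  exact pow_dvd_pow p h

theorem mul_sub_mul_add_eq_zero {R : Type*} [CommRing R] {c m n : R} (hm : IsUnit m)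
    {u u₀ : Rˣ} (h : c * (m * u - n * (u⁻¹ : Rˣ)) = 0)
    (h₀ : c * (m * u₀ - n * (u₀⁻¹ : Rˣ)) = 0) : c * ((u - u₀) * (u + u₀)) = 0 := by
  refine hm.mul_left_eq_zero.1 ?_
  linear_combination u * h - u₀ * h₀ + c * n * u.mul_inv - c * n * u₀.mul_inv

open Classical in
/-- If each solution `u` is close to `u₀` or to `-u₀`, there are at most `2 * c` solutions. -/
theorem card_units_filter_le {N : ℕ} [NeZero N] {c : ℕ} (hc : 0 < c) (P : (ZMod N)ˣ → Prop)
    (h : ∀ u u₀, P u → P u₀ → (c : ZMod N) * (u - u₀) = 0 ∨ (c : ZMod N) * (u + u₀) = 0) :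
    (Finset.univ.filter P).card ≤ 2 * c := by
  obtain hempty | ⟨u₀, hu₀⟩ := (Finset.univ.filter P).eq_empty_or_nonempty
  · simp [hempty]
  have h₀ : P u₀ := (Finset.mem_filter.1 hu₀).2
  calc (Finset.univ.filter P).card ≤
      ((Finset.univ.filter fun x : ZMod N => (c : ZMod N) * (x - u₀) = 0) ∪
        (Finset.univ.filter fun x : ZMod N => (c : ZMod N) * (x - -u₀) = 0)).card := by
        refine Finset.card_le_card_of_injOn (fun u => (u : ZMod N)) ?_ Units.val_injective.injOn
        intro u hu
        have := h u u₀ (Finset.mem_filter.1 hu).2 h₀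
        simpa [sub_neg_eq_add] using this
    _ ≤ c + c := (Finset.card_union_le _ _).trans (add_le_add
        (by convert ZMod.card_natCast_mul_sub_eq_zero_le hc (u₀ : ZMod N))
        (by convert ZMod.card_natCast_mul_sub_eq_zero_le hc (-u₀ : ZMod N)))
    _ = _ := by ring

section PrimePow

variable {p : ℕ} [Fact p.Prime] {k : ℕ}

theorem ZMod.isUnit_or_prime_dvd (x : ZMod (p ^ k)) : IsUnit x ∨ (p : ZMod (p ^ k)) ∣ x := by
  have hp : p.Prime := Fact.out
  rw [← ZMod.natCast_zmod_val x]
  by_cases h : p ∣ x.val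
  · exact Or.inr (Nat.cast_dvd_cast h)
  · exact Or.inl ((ZMod.isUnit_iff_coprime _ _).2
      (((hp.coprime_iff_not_dvd).2 h).symm.pow_right k))

theorem ZMod.not_prime_dvd_of_isUnit (hk : k ≠ 0) {x : ZMod (p ^ k)} (hx : IsUnit x) :
    ¬ (p : ZMod (p ^ k)) ∣ x := by
  intro h
  have h1 := isUnit_of_dvd_unit h hx
  exact ZMod.isUnit_prime_iff_not_dvd Fact.out |>.1 h1 (dvd_pow_self p hk)

theorem ZMod.natCast_pow_mul_eq_zero_iff {j : ℕ} {x : ZMod (p ^ k)} (hx : IsUnit x) :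
    (p : ZMod (p ^ k)) ^ j * x = 0 ↔ k ≤ j := by
  have hp : p.Prime := Fact.out
  rw [hx.mul_left_eq_zero, ← Nat.cast_pow, ZMod.natCast_eq_zero_iff,
    Nat.pow_dvd_pow_iff_le_right hp.one_lt]

theorem kloostermanSum_prime_mul (m n : ℤ) :
    kloostermanSum (ZMod.stdAddChar (N := p ^ (k + 2))) ((p * m : ℤ) : ZMod (p ^ (k + 2)))
        ((p * n : ℤ) : ZMod (p ^ (k + 2))) =
      p * kloostermanSum (ZMod.stdAddChar (N := p ^ (k + 1))) (m : ZMod (p ^ (k + 1)))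
        (n : ZMod (p ^ (k + 1))) := by
  have hp : p.Prime := Fact.out
  have hpC : (p : ℂ) ≠ 0 := by exact_mod_cast hp.ne_zero
  have hdvd : p ^ (k + 1) ∣ p ^ (k + 2) := pow_dvd_pow p (by omega)
  have hchar : ∀ j : ℤ, ZMod.stdAddChar (N := p ^ (k + 2)) ((p * j : ℤ) : ZMod (p ^ (k + 2))) =
      ZMod.stdAddChar (N := p ^ (k + 1)) (j : ZMod (p ^ (k + 1))) := by
    intro j
    rw [ZMod.stdAddChar_coe, ZMod.stdAddChar_coe]
    congr 1
    push_cast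
    field_simp
    ring
  have hcast : ∀ x : ZMod (p ^ (k + 2)), ((x.cast : ℤ) : ZMod (p ^ (k + 1))) =
      ZMod.castHom hdvd (ZMod (p ^ (k + 1))) x := by
    intro x
    conv_rhs => rw [← ZMod.intCast_zmod_cast x, map_intCast]
  have hterm : ∀ u : (ZMod (p ^ (k + 2)))ˣ,
      ZMod.stdAddChar (N := p ^ (k + 2)) (((p * m : ℤ) : ZMod (p ^ (k + 2))) * u +
        ((p * n : ℤ) : ZMod (p ^ (k + 2))) * (u⁻¹ : (ZMod (p ^ (k + 2)))ˣ)) =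
      ZMod.stdAddChar (N := p ^ (k + 1)) ((m : ZMod (p ^ (k + 1))) * (ZMod.unitsMap hdvd u) +
        (n : ZMod (p ^ (k + 1))) * ((ZMod.unitsMap hdvd u)⁻¹ : (ZMod (p ^ (k + 1)))ˣ)) := by
    intro u
    have h := hchar (m * (u : ZMod (p ^ (k + 2))).cast +
      n * ((u⁻¹ : (ZMod (p ^ (k + 2)))ˣ) : ZMod (p ^ (k + 2))).cast)
    push_cast at h
    rw [hcast, hcast] at h
    rw [← map_inv]
    push_cast
    rw [mul_assoc, mul_assoc, ← mul_add, h]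
    rfl
  have h := card_mul_sum_comp_monoidHom (ZMod.unitsMap_surjective hdvd) fun v =>
    ZMod.stdAddChar (N := p ^ (k + 1)) ((m : ZMod (p ^ (k + 1))) * v + (n : ZMod (p ^ (k + 1))) *
      (v⁻¹ : (ZMod (p ^ (k + 1)))ˣ))
  rw [ZMod.card_units_eq_totient, ZMod.card_units_eq_totient, Nat.totient_prime_pow_succ hp,
    Nat.totient_prime_pow_succ hp] at h
  have h0 : ((p ^ k * (p - 1) : ℕ) : ℂ) ≠ 0 := by
    have := hp.one_lt
    exact_mod_cast (Nat.mul_pos (pow_pos hp.pos k) (by omega)).ne'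
  rw [kloostermanSum, Finset.sum_congr rfl fun u _ => hterm u]
  refine mul_left_cancel₀ h0 (h.trans ?_)
  have h1 : ((p ^ (k + 1) * (p - 1) : ℕ) : ℂ) = (p ^ k * (p - 1) : ℕ) * p := by
    rw [pow_succ, mul_right_comm, Nat.cast_mul]
  rw [kloostermanSum, h1, mul_assoc]

theorem card_stationary_le_of_ne_two (hp2 : p ≠ 2) (hk : k ≠ 0) (b : ℕ) {m n : ZMod (p ^ k)}
    (hm : IsUnit m) :
    (Finset.univ.filter fun u : (ZMod (p ^ k))ˣ =>
      (p : ZMod (p ^ k)) ^ b * (m * u - n * (u⁻¹ : (ZMod (p ^ k))ˣ)) = 0).card ≤ 2 * p ^ b := by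
  have hp : p.Prime := Fact.out
  convert card_units_filter_le (pow_pos hp.pos b) _ fun u u₀ h h₀ => ?_
  push_cast
  have h2 := mul_sub_mul_add_eq_zero hm h h₀
  rcases ZMod.isUnit_or_prime_dvd (p := p) (k := k) ((u : ZMod (p ^ k)) - u₀) with h3 | h3
  · right
    refine h3.mul_left_eq_zero.1 ?_
    linear_combination h2
  rcases ZMod.isUnit_or_prime_dvd (p := p) (k := k) ((u : ZMod (p ^ k)) + u₀) with h4 | h4
  · left
    refine h4.mul_left_eq_zero.1 ?_
    linear_combination h2
  have h5 : IsUnit (2 : ZMod (p ^ k)) := by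
    have : Nat.Coprime 2 (p ^ k) := ((Nat.coprime_primes Nat.prime_two hp).2 hp2.symm).pow_right k
    exact_mod_cast (ZMod.isUnit_iff_coprime 2 (p ^ k)).2 this
  refine absurd ?_ (ZMod.not_prime_dvd_of_isUnit hk (h5.mul u.isUnit))
  have := dvd_add h3 h4
  rwa [show (u : ZMod (p ^ k)) - u₀ + (u + u₀) = 2 * u by ring] at this

theorem card_stationary_le_of_two (hk : k ≠ 0) (b : ℕ) {m n : ZMod (2 ^ k)} (hm : IsUnit m) :
    (Finset.univ.filter fun u : (ZMod (2 ^ k))ˣ =>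
      ((2 : ℕ) : ZMod (2 ^ k)) ^ b * (m * u - n * (u⁻¹ : (ZMod (2 ^ k))ˣ)) = 0).card ≤
        4 * 2 ^ b := by
  have hdvd : 2 ∣ 2 ^ k := dvd_pow_self 2 hk
  refine le_of_le_of_eq (b := 2 * 2 ^ (b + 1)) ?_ (by ring)
  convert card_units_filter_le (pow_pos two_pos (b + 1)) _ fun u u₀ h h₀ => ?_
  have h2 := mul_sub_mul_add_eq_zero hm h h₀
  have hodd : ∀ v w : (ZMod (2 ^ k))ˣ, ¬ IsUnit ((v : ZMod (2 ^ k)) - w) := by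
    intro v w hvw
    have h3 := hvw.map (ZMod.castHom hdvd (ZMod 2))
    have h4 : ∀ v : (ZMod (2 ^ k))ˣ, ZMod.castHom hdvd (ZMod 2) v = 1 := fun v => by
      have h5 := (v.isUnit.map (ZMod.castHom hdvd (ZMod 2))).ne_zero
      revert h5
      generalize ZMod.castHom hdvd (ZMod 2) (v : ZMod (2 ^ k)) = x
      revert x
      decide
    rw [map_sub, h4, h4, sub_self] at h3
    exact h3.ne_zero rfl
  obtain ⟨d, hd⟩ := (ZMod.isUnit_or_prime_dvd (p := 2) (k := k)
    ((u : ZMod (2 ^ k)) - u₀)).resolve_left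
    (hodd u u₀)
  push_cast at hd h2 ⊢
  rcases ZMod.isUnit_or_prime_dvd (p := 2) (k := k) d with h3 | h3
  · right
    refine h3.mul_left_eq_zero.1 ?_
    linear_combination h2 - 2 ^ b * (u + u₀) * hd
  rcases ZMod.isUnit_or_prime_dvd (p := 2) (k := k) (d + u₀) with h4 | h4
  · left
    refine h4.mul_left_eq_zero.1 ?_
    linear_combination h2 - 2 ^ b * (u - u₀) * hd
  refine absurd ?_ (ZMod.not_prime_dvd_of_isUnit (p := 2) hk u₀.isUnit)
  have := dvd_sub h4 h3
  rwa [add_sub_cancel_left] at this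

end PrimePow

section PrimePow

variable {p : ℕ} [Fact p.Prime]

theorem kloostermanSum_eq_zero_of_isUnit_add_dvd {k b : ℕ} (hkb : k ≤ 2 * b) (hbk : b < k)
    {m n : ZMod (p ^ k)} (h : IsUnit m ∧ (p : ZMod (p ^ k)) ∣ n ∨
      (p : ZMod (p ^ k)) ∣ m ∧ IsUnit n) :
    kloostermanSum (ZMod.stdAddChar (N := p ^ k)) m n = 0 := by
  rw [kloostermanSum_eq_sum_filter (ZMod.isPrimitive_stdAddChar _) m n
    (e := (p : ZMod (p ^ k)) ^ b) (by rw [← pow_mul]; exact ZMod.natCast_pow_eq_zero (by omega)),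
    Finset.filter_eq_empty_iff.2, Finset.sum_empty]
  intro u _ hu
  have hunit : IsUnit (m * u - n * (u⁻¹ : (ZMod (p ^ k))ˣ)) := by
    refine (ZMod.isUnit_or_prime_dvd _).resolve_right fun hd => ?_
    rcases h with ⟨hm, hn⟩ | ⟨hm, hn⟩
    · refine ZMod.not_prime_dvd_of_isUnit (by omega) (hm.mul u.isUnit) ?_
      exact (dvd_sub_left (hn.mul_right _)).1 hd
    · refine ZMod.not_prime_dvd_of_isUnit (by omega) (hn.mul u⁻¹.isUnit) ?_
      exact (dvd_sub_right (hm.mul_right _)).1 hd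
  rw [ZMod.natCast_pow_mul_eq_zero_iff hunit] at hu
  omega

theorem norm_kloostermanSum_le_card_stationary {k b : ℕ} (hkb : k ≤ 2 * b) (m n : ZMod (p ^ k)) :
    ‖kloostermanSum (ZMod.stdAddChar (N := p ^ k)) m n‖ ≤
      (Finset.univ.filter fun u : (ZMod (p ^ k))ˣ =>
        (p : ZMod (p ^ k)) ^ b * (m * u - n * (u⁻¹ : (ZMod (p ^ k))ˣ)) = 0).card := by
  rw [kloostermanSum_eq_sum_filter (ZMod.isPrimitive_stdAddChar _) m n
    (e := (p : ZMod (p ^ k)) ^ b) (by rw [← pow_mul]; exact ZMod.natCast_pow_eq_zero (by omega))]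
  refine (norm_sum_le _ _).trans (le_of_eq ?_)
  simp [AddChar.norm_apply]

theorem norm_sq_sum_quadratic_prime_pow_le (hp2 : p ≠ 2) (a : ℕ) {v w : ZMod (p ^ (2 * a + 1))}
    (hv : IsUnit v) :
    ‖∑ z, ZMod.stdAddChar (N := p ^ (2 * a + 1)) ((p : ZMod (p ^ (2 * a + 1))) ^ a * z * w +
        ((p : ZMod (p ^ (2 * a + 1))) ^ a) ^ 2 * z ^ 2 * v)‖ ^ 2 ≤
      if (p : ZMod (p ^ (2 * a + 1))) ^ (a + 1) * w = 0 then (p : ℝ) ^ (4 * a + 1) else 0 := by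
  have hp : p.Prime := Fact.out
  let R := ZMod (p ^ (2 * a + 1))
  set ψ := ZMod.stdAddChar (N := p ^ (2 * a + 1)) with hψdef
  have hψ : ψ.IsPrimitive := ZMod.isPrimitive_stdAddChar _
  set e : R := (p : R) ^ a with he
  have h2 : IsUnit (2 : R) := by
    have : Nat.Coprime 2 (p ^ (2 * a + 1)) :=
      ((Nat.coprime_primes Nat.prime_two hp).2 hp2.symm).pow_right _
    exact_mod_cast (ZMod.isUnit_iff_coprime 2 (p ^ (2 * a + 1))).2 this
  have hep : (p : R) * e ^ 2 = 0 := by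
    rw [he, ← pow_mul, ← pow_succ']
    exact ZMod.natCast_pow_eq_zero (by omega)
  have hmain := norm_sq_sum_addChar_quadratic hψ (e * w) (e ^ 2 * v)
  have hrw : ∑ z, ψ (e * z * w + e ^ 2 * z ^ 2 * v) = ∑ z, ψ (e * w * z + e ^ 2 * v * z ^ 2) :=
    Finset.sum_congr rfl fun z _ => by congr 1; ring
  have hfilter : ∀ h : R, 2 * (e ^ 2 * v) * h = 0 ↔ e ^ 2 * h = 0 := fun h => by
    rw [show 2 * (e ^ 2 * v) * h = (2 * v) * (e ^ 2 * h) by ring, (h2.mul hv).mul_right_eq_zero]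
  simp only [hfilter] at hmain
  have hS : ∑ h : R with e ^ 2 * h = 0, ψ (e * w * h + e ^ 2 * v * h ^ 2) =
      ∑ h : R with e ^ 2 * h = 0, ψ (e * w * h) := by
    refine Finset.sum_congr rfl fun h hh => ?_
    congr 1
    linear_combination v * h * (Finset.mem_filter.1 hh).2
  rw [hS, ZMod.card] at hmain
  rw [hrw]
  split_ifs with hw
  · have hcard : (Finset.univ.filter fun h : R => e ^ 2 * h = 0).card ≤ p ^ (2 * a) := by
      have := ZMod.card_natCast_mul_sub_eq_zero_le (pow_pos hp.pos (2 * a)) (0 : R)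
      push_cast at this
      simpa only [sub_zero, mul_comm 2 a, pow_mul] using this
    rw [← Complex.norm_of_nonneg (sq_nonneg _), hmain, norm_mul, Complex.norm_natCast]
    calc _ ≤ ((p ^ (2 * a + 1) : ℕ) : ℝ) *
          (Finset.univ.filter fun h : R => e ^ 2 * h = 0).card := by
          gcongr
          refine (norm_sum_le _ _).trans (le_of_eq ?_)
          simp [AddChar.norm_apply]
      _ ≤ ((p ^ (2 * a + 1) : ℕ) : ℝ) * (p ^ (2 * a) : ℕ) := by gcongr
      _ = _ := by push_cast; ring
  · have hz : ∃ z : R, ψ ((p : R) ^ (a + 1) * w * z) ≠ 1 := by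
      by_contra! hall
      exact hψ hw (by ext z; simpa [AddChar.mulShift_apply] using hall z)
    obtain ⟨z, hz⟩ := hz
    set S := ∑ h : R with e ^ 2 * h = 0, ψ (e * w * h) with hSdef
    have hshift : S = ψ ((p : R) ^ (a + 1) * w * z) * S := by
      rw [hSdef, Finset.mul_sum]
      refine Finset.sum_bij' (fun h _ => h - p * z) (fun h _ => h + p * z) ?_ ?_ ?_ ?_ ?_
      · intro h hh
        simp only [Finset.mem_filter, Finset.mem_univ, true_and] at hh ⊢
        linear_combination hh - z * hep
      · intro h hh
        simp only [Finset.mem_filter, Finset.mem_univ, true_and] at hh ⊢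
        linear_combination hh + z * hep
      · intro h _; ring
      · intro h _; ring
      · intro h _
        rw [← AddChar.map_add_eq_mul]
        congr 1
        rw [he]
        ring
    have hS0 : S = 0 := by
      have h3 : (ψ ((p : R) ^ (a + 1) * w * z) - 1) * S = 0 := by linear_combination -hshift
      exact (mul_eq_zero.1 h3).resolve_left (sub_ne_zero.2 hz)
    rw [hS0, mul_zero] at hmain
    exact (Complex.ofReal_eq_zero.1 hmain).le

theorem norm_kloostermanSum_odd_pow_le (hp2 : p ≠ 2) {a : ℕ} (ha : a ≠ 0)
    {m n : ZMod (p ^ (2 * a + 1))} (hm : IsUnit m) (hn : IsUnit n) :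
    ‖kloostermanSum (ZMod.stdAddChar (N := p ^ (2 * a + 1))) m n‖ ≤ 2 * √((p : ℝ) ^ (2 * a + 1)) := by
  have hp : p.Prime := Fact.out
  have hp0 : (0 : ℝ) < p := by exact_mod_cast hp.pos
  have havg := card_mul_kloostermanSum_eq (ZMod.stdAddChar (N := p ^ (2 * a + 1))) m n
    (e := (p : ZMod (p ^ (2 * a + 1))) ^ a)
    (by rw [← pow_mul]; exact ZMod.natCast_pow_eq_zero (by omega))
  have hnorm := congrArg norm havg
  rw [norm_mul, Complex.norm_natCast, ZMod.card] at hnorm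
  have hG : ∀ u : (ZMod (p ^ (2 * a + 1)))ˣ, ‖_‖ ≤ _ := fun u => Real.le_sqrt_of_sq_le
    (norm_sq_sum_quadratic_prime_pow_le hp2 a (w := m * u - n * (u⁻¹ : (ZMod (p ^ (2 * a + 1)))ˣ))
      (hn.mul u⁻¹.isUnit))
  have hsqrt : √((p : ℝ) ^ (4 * a + 1)) = (p : ℝ) ^ (2 * a) * √p := by
    rw [pow_succ, Real.sqrt_mul (by positivity), show 4 * a = 2 * a * 2 by ring, pow_mul _ (2 * a),
      Real.sqrt_sq (by positivity)]
  have hsqrt' : √((p : ℝ) ^ (2 * a + 1)) = (p : ℝ) ^ a * √p := by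
    rw [pow_succ, Real.sqrt_mul (by positivity), mul_comm 2 a, pow_mul,
      Real.sqrt_sq (by positivity)]
  have hbound : ((p ^ (2 * a + 1) : ℕ) : ℝ) *
      ‖kloostermanSum (ZMod.stdAddChar (N := p ^ (2 * a + 1))) m n‖ ≤
        (2 * p ^ (a + 1) : ℕ) * ((p : ℝ) ^ (2 * a) * √p) := by
    rw [hnorm]
    refine (norm_sum_le _ _).trans ?_
    calc _ ≤ ∑ u : (ZMod (p ^ (2 * a + 1)))ˣ, √(if (p : ZMod (p ^ (2 * a + 1))) ^ (a + 1) *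
          (m * u - n * (u⁻¹ : (ZMod (p ^ (2 * a + 1)))ˣ)) = 0 then (p : ℝ) ^ (4 * a + 1) else 0) :=
        Finset.sum_le_sum fun u _ => by
          rw [norm_mul, AddChar.norm_apply, one_mul]
          exact hG u
      _ = ((Finset.univ.filter fun u : (ZMod (p ^ (2 * a + 1)))ˣ =>
          (p : ZMod (p ^ (2 * a + 1))) ^ (a + 1) *
            (m * u - n * (u⁻¹ : (ZMod (p ^ (2 * a + 1)))ˣ)) = 0).card : ℝ) *
          ((p : ℝ) ^ (2 * a) * √p) := by
          rw [← hsqrt, ← nsmul_eq_mul, ← Finset.sum_const, Finset.sum_filter]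
          exact Finset.sum_congr rfl fun u _ => by split_ifs <;> simp
      _ ≤ _ := by
          gcongr
          exact card_stationary_le_of_ne_two hp2 (by omega) _ hm
  rw [hsqrt']
  push_cast at hbound
  refine le_of_mul_le_mul_left (hbound.trans_eq ?_) (pow_pos hp0 (2 * a + 1))
  ring

theorem norm_kloostermanSum_prime_pow_le {k : ℕ} (hk : 2 ≤ k) {m n : ZMod (p ^ k)}
    (hm : IsUnit m) (hn : IsUnit n) :
    ‖kloostermanSum (ZMod.stdAddChar (N := p ^ k)) m n‖ ≤ (k + 1) * √((p : ℝ) ^ k) := by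
  have hp : p.Prime := Fact.out
  have hp0 : (0 : ℝ) < p := by exact_mod_cast hp.pos
  have hk' : (2 : ℝ) ≤ k + 1 := by
    have : (2 : ℝ) ≤ k := by exact_mod_cast hk
    linarith
  by_cases hp2 : p = 2
  · subst hp2
    by_cases hk5 : k ≤ 4
    · refine (norm_kloostermanSum_le_card _ m n).trans ?_
      rw [ZMod.card_units_eq_totient]
      refine le_trans (Nat.cast_le.2 (Nat.totient_le _)) ?_
      have h1 : (2 : ℝ) ^ k = √((2 : ℝ) ^ k) * √((2 : ℝ) ^ k) :=
        (Real.mul_self_sqrt (by positivity)).symm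
      push_cast
      rw [h1, Real.sqrt_mul_self (by positivity)]
      gcongr
      refine Real.sqrt_le_iff.2 ⟨by positivity, ?_⟩
      interval_cases k <;> norm_num
    · have h1 := norm_kloostermanSum_le_card_stationary (p := 2) (k := k) (b := (k + 1) / 2)
        (by omega) m n
      refine h1.trans (le_trans (Nat.cast_le.2 (card_stationary_le_of_two (by omega) _ hm)) ?_)
      refine (sq_le_sq₀ (by positivity) (by positivity)).1 ?_
      rw [mul_pow, Real.sq_sqrt (by positivity)]
      push_cast
      have h2 : ((2 : ℝ) ^ ((k + 1) / 2)) ^ 2 ≤ 2 * 2 ^ k := by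
        rw [← pow_mul, ← pow_succ']
        exact pow_le_pow_right₀ one_le_two (by omega)
      have h3 : (6 : ℝ) ≤ k + 1 := by
        have : (5 : ℝ) ≤ k := by exact_mod_cast (by omega : 5 ≤ k)
        linarith
      have h4 : (0 : ℝ) < 2 ^ k := by positivity
      nlinarith [mul_le_mul h3 h3 (by norm_num) (by linarith)]
  · suffices h : ‖kloostermanSum (ZMod.stdAddChar (N := p ^ k)) m n‖ ≤ 2 * √((p : ℝ) ^ k) from
      h.trans (by gcongr)
    obtain ⟨a, rfl | rfl⟩ := k.even_or_odd'
    · have h1 := norm_kloostermanSum_le_card_stationary (b := a) le_rfl m n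
      refine h1.trans (le_trans (Nat.cast_le.2
        (card_stationary_le_of_ne_two hp2 (by omega) _ hm)) (le_of_eq ?_))
      rw [mul_comm 2 a, pow_mul, Real.sqrt_sq (by positivity)]
      push_cast
      ring
    · exact norm_kloostermanSum_odd_pow_le hp2 (by omega) hm hn

end PrimePow

/-- The Weil–Estermann bound for Kloosterman sums to the modulus `q`. -/
def KloostermanBound (q : ℕ) : Prop :=
  ∀ [NeZero q] (m n : ℤ), ‖kloostermanSum (ZMod.stdAddChar (N := q)) m n‖ ≤
    q.divisors.card * √q * √(Nat.gcd (Int.gcd m n) q)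

theorem kloostermanBound_one : KloostermanBound 1 := by
  intro _ m n
  refine (norm_kloostermanSum_le_card _ _ _).trans ?_
  simp

theorem kloostermanBound_prime {p : ℕ} (hp : p.Prime) : KloostermanBound p := by
  intro _ m n
  have : Fact p.Prime := ⟨hp⟩
  have h := norm_kloostermanSum_prime_le p m n
  rw [hp.divisors, Finset.card_pair hp.one_lt.ne]
  exact_mod_cast h

theorem kloostermanBound_prime_pow {p : ℕ} (hp : p.Prime) (k : ℕ) :
    KloostermanBound (p ^ (k + 1)) := by
  have : Fact p.Prime := ⟨hp⟩
  have hcard : ∀ k, (p ^ k).divisors.card = k + 1 := fun k => by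
    rw [Nat.divisors_prime_pow hp, Finset.card_map, Finset.card_range]
  have hp0 : (0 : ℝ) ≤ p := by positivity
  induction k with
  | zero =>
    rw [zero_add, pow_one]
    exact @kloostermanBound_prime p hp
  | succ k ih =>
    intro _ m n
    have hdvd : ∀ m : ℤ, (p : ZMod (p ^ (k + 2))) ∣ (m : ZMod (p ^ (k + 2))) → (p : ℤ) ∣ m := by
      intro m h
      have h1 := map_dvd (ZMod.castHom (dvd_pow_self p (by omega : k + 2 ≠ 0)) (ZMod p)) h
      rw [map_natCast, map_intCast, CharP.cast_eq_zero, zero_dvd_iff,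
        ZMod.intCast_zmod_eq_zero_iff_dvd] at h1
      exact h1
    have hnonneg : (0 : ℝ) ≤ (p ^ (k + 2)).divisors.card * √(p ^ (k + 2) : ℕ) *
        √(Nat.gcd (Int.gcd m n) (p ^ (k + 2))) := by positivity
    rcases ZMod.isUnit_or_prime_dvd (p := p) (k := k + 2) (m : ZMod (p ^ (k + 2))) with hm | hm <;>
    rcases ZMod.isUnit_or_prime_dvd (p := p) (k := k + 2) (n : ZMod (p ^ (k + 2))) with hn | hn
    · refine (norm_kloostermanSum_prime_pow_le (by omega) hm hn).trans ?_
      rw [hcard]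
      push_cast
      rw [show (k : ℝ) + 2 + 1 = k + 1 + 1 + 1 by ring]
      refine le_mul_of_one_le_right (by positivity) (Real.one_le_sqrt.2 ?_)
      exact_mod_cast Nat.gcd_pos_of_pos_right _ (pow_pos hp.pos _)
    · rw [kloostermanSum_eq_zero_of_isUnit_add_dvd (b := k + 1) (by omega) (by omega)
        (Or.inl ⟨hm, hn⟩), norm_zero]
      exact hnonneg
    · rw [kloostermanSum_eq_zero_of_isUnit_add_dvd (b := k + 1) (by omega) (by omega)
        (Or.inr ⟨hm, hn⟩), norm_zero]
      exact hnonneg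
    · obtain ⟨m, rfl⟩ := hdvd m hm
      obtain ⟨n, rfl⟩ := hdvd n hn
      have hg : Nat.gcd (Int.gcd (p * m) (p * n)) (p ^ (k + 2)) =
          p * Nat.gcd (Int.gcd m n) (p ^ (k + 1)) := by
        rw [Int.gcd_mul_left, Int.natAbs_natCast, pow_succ' p (k + 1), Nat.gcd_mul_left]
      have h := ih m n
      rw [hcard] at h
      rw [kloostermanSum_prime_mul, norm_mul, Complex.norm_natCast, hcard, hg]
      push_cast at h ⊢
      rw [pow_succ (p : ℝ) (k + 1), Real.sqrt_mul (by positivity), Real.sqrt_mul hp0]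
      set A := √((p : ℝ) ^ (k + 1))
      set B := √(Nat.gcd (Int.gcd m n) (p ^ (k + 1)) : ℝ)
      have hAB : 0 ≤ A * B := by positivity
      calc _ ≤ (p : ℝ) * ((k + 1 + 1) * A * B) := by gcongr
        _ ≤ p * ((k + 1 + 1 + 1) * A * B) := by gcongr; linarith
        _ = (√p * √p) * ((k + 1 + 1 + 1) * A * B) := by rw [Real.mul_self_sqrt hp0]
        _ = _ := by ring

theorem kloostermanSum_mul_of_coprime {q r : ℕ} [NeZero q] [NeZero r] [NeZero (q * r)]
    (hqr : q.Coprime r) {a b : ℤ} (hab : a * q + b * r = 1) (m n : ℤ) :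
    kloostermanSum (ZMod.stdAddChar (N := q * r)) m n =
      kloostermanSum (ZMod.stdAddChar (N := q)) ((b * m : ℤ) : ZMod q) ((b * n : ℤ) : ZMod q) *
      kloostermanSum (ZMod.stdAddChar (N := r)) ((a * m : ℤ) : ZMod r) ((a * n : ℤ) : ZMod r) := by
  have hq : (q : ℂ) ≠ 0 := by exact_mod_cast NeZero.ne q
  have hr : (r : ℂ) ≠ 0 := by exact_mod_cast NeZero.ne r
  have habC : (a : ℂ) * q + b * r = 1 := by exact_mod_cast congrArg (Int.cast : ℤ → ℂ) hab
  have hchar : ∀ j : ℤ, ZMod.stdAddChar (N := q * r) j =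
      ZMod.stdAddChar (N := q) ((b * j : ℤ) : ZMod q) *
        ZMod.stdAddChar (N := r) ((a * j : ℤ) : ZMod r) := by
    intro j
    rw [ZMod.stdAddChar_coe, ZMod.stdAddChar_coe, ZMod.stdAddChar_coe, ← Complex.exp_add]
    congr 1
    push_cast
    field_simp
    linear_combination -(j : ℂ) * habC
  let φ := ZMod.chineseRemainder hqr
  have hφ : ∀ x : ZMod (q * r), φ x = (((x.cast : ℤ) : ZMod q), ((x.cast : ℤ) : ZMod r)) := by
    intro x
    conv_lhs => rw [← ZMod.intCast_zmod_cast x, map_intCast]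
    rfl
  let θ : (ZMod (q * r))ˣ ≃* (ZMod q)ˣ × (ZMod r)ˣ :=
    (Units.mapEquiv φ.toMulEquiv).trans MulEquiv.prodUnits
  have hθ1 : ∀ u, (((θ u).1 : (ZMod q)ˣ) : ZMod q) = (((u : ZMod (q * r)).cast : ℤ) : ZMod q) :=
    fun u => congrArg Prod.fst (hφ u)
  have hθ2 : ∀ u, (((θ u).2 : (ZMod r)ˣ) : ZMod r) = (((u : ZMod (q * r)).cast : ℤ) : ZMod r) :=
    fun u => congrArg Prod.snd (hφ u)
  rw [kloostermanSum, kloostermanSum, kloostermanSum, Finset.sum_mul_sum, ← Fintype.sum_prod_type']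
  refine Fintype.sum_equiv θ.toEquiv _ _ fun u => ?_
  have h := hchar (m * (u : ZMod (q * r)).cast +
    n * ((u⁻¹ : (ZMod (q * r))ˣ) : ZMod (q * r)).cast)
  have hinv1 : (((θ u).1)⁻¹ : (ZMod q)ˣ) = (θ u⁻¹).1 := by rw [map_inv, Prod.fst_inv]
  have hinv2 : (((θ u).2)⁻¹ : (ZMod r)ˣ) = (θ u⁻¹).2 := by rw [map_inv, Prod.snd_inv]
  change _ = ZMod.stdAddChar (N := q) (_ * ((θ u).1 : ZMod q) +
    _ * (((θ u).1)⁻¹ : (ZMod q)ˣ)) * ZMod.stdAddChar (N := r) (_ * ((θ u).2 : ZMod r) +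
      _ * (((θ u).2)⁻¹ : (ZMod r)ˣ))
  rw [hinv1, hinv2, hθ1, hθ2, hθ1, hθ2]
  rw [Int.cast_add, Int.cast_mul, Int.cast_mul, ZMod.intCast_zmod_cast,
    ZMod.intCast_zmod_cast] at h
  rw [h]
  congr 2 <;> push_cast <;> ring

theorem gcd_gcd_mul_of_coprime {q : ℕ} {b : ℤ} (hb : IsCoprime b q) (m n : ℤ) :
    Nat.gcd (Int.gcd (b * m) (b * n)) q = Nat.gcd (Int.gcd m n) q := by
  rw [Int.gcd_mul_left]
  exact Nat.Coprime.gcd_mul_left_cancel _ (Int.isCoprime_iff_gcd_eq_one.1 hb)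

theorem KloostermanBound.mul {q r : ℕ} (hqr : q.Coprime r) (hq : KloostermanBound q)
    (hr : KloostermanBound r) : KloostermanBound (q * r) := by
  intro hne m n
  have : NeZero q := ⟨left_ne_zero_of_mul hne.ne⟩
  have : NeZero r := ⟨right_ne_zero_of_mul hne.ne⟩
  obtain ⟨a, b, hab⟩ := Nat.isCoprime_iff_coprime.2 hqr
  rw [kloostermanSum_mul_of_coprime hqr hab, norm_mul]
  have h1 := hq (b * m) (b * n)
  have h2 := hr (a * m) (a * n)
  rw [gcd_gcd_mul_of_coprime ⟨r, a, by linear_combination hab⟩] at h1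
  rw [gcd_gcd_mul_of_coprime ⟨q, b, by linear_combination hab⟩] at h2
  refine (mul_le_mul h1 h2 (norm_nonneg _) (by positivity)).trans_eq ?_
  rw [hqr.card_divisors_mul, hqr.gcd_mul]
  push_cast
  rw [Real.sqrt_mul (by positivity), Real.sqrt_mul (by positivity)]
  ring

theorem kloostermanBound {q : ℕ} (hq : q ≠ 0) : KloostermanBound q := by
  induction q using Nat.recOnPosPrimePosCoprime with
  | prime_pow p k hp hk =>
    obtain ⟨k, rfl⟩ := Nat.exists_eq_add_one_of_ne_zero hk.ne'
    exact kloostermanBound_prime_pow hp k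
  | zero => exact absurd rfl hq
  | one => exact kloostermanBound_one
  | coprime a b ha hb hab iha ihb =>
    exact KloostermanBound.mul hab (iha (by omega)) (ihb (by omega))

theorem sum_exp_eq_kloostermanSum {q : ℕ} [NeZero q] (m n : ℤ) (inv : ℕ → ℤ)
    (hinv : ∀ x : ℕ, 1 ≤ x → x ≤ q → Nat.gcd x q = 1 → (x : ℤ) * inv x ≡ 1 [ZMOD (q : ℤ)]) :
    ∑ x ∈ (Finset.Icc 1 q).filter (fun x => Nat.gcd x q = 1),
        eAdd (((m * (x : ℤ) + n * inv x : ℤ) : ℝ) / (q : ℝ)) =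
      kloostermanSum (ZMod.stdAddChar (N := q)) m n := by
  have hq : 0 < q := Nat.pos_of_ne_zero (NeZero.ne q)
  refine Finset.sum_bij (fun x hx => ZMod.unitOfCoprime x (Finset.mem_filter.1 hx).2)
    (fun _ _ => Finset.mem_univ _) ?_ ?_ ?_
  · intro x hx y hy h
    have h1 := congrArg Units.val h
    rw [ZMod.coe_unitOfCoprime, ZMod.coe_unitOfCoprime, ZMod.natCast_eq_natCast_iff] at h1
    obtain ⟨hx1, hx2⟩ := Finset.mem_Icc.1 (Finset.mem_filter.1 hx).1
    obtain ⟨hy1, hy2⟩ := Finset.mem_Icc.1 (Finset.mem_filter.1 hy).1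
    have h2 : (q : ℤ) ∣ (y : ℤ) - x := (Nat.modEq_iff_dvd).1 h1
    have h3 := Int.eq_zero_of_abs_lt_dvd h2 (by rw [abs_lt]; omega)
    omega
  · intro u _
    obtain ⟨x, hx1, hx2⟩ : ∃ x ∈ Finset.Icc 1 q, (x : ZMod q) = u := by
      by_cases h0 : (u : ZMod q).val = 0
      · refine ⟨q, Finset.mem_Icc.2 ⟨hq, le_rfl⟩, ?_⟩
        rw [ZMod.natCast_self, (ZMod.val_eq_zero _).1 h0]
      · exact ⟨(u : ZMod q).val, Finset.mem_Icc.2 ⟨Nat.pos_of_ne_zero h0, (ZMod.val_lt _).le⟩,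
          ZMod.natCast_zmod_val _⟩
    have hc : x.Coprime q := (ZMod.isUnit_iff_coprime x q).1 (hx2 ▸ u.isUnit)
    exact ⟨x, Finset.mem_filter.2 ⟨hx1, hc⟩, Units.ext (by rw [ZMod.coe_unitOfCoprime, hx2])⟩
  · intro x hx
    have hc := (Finset.mem_filter.1 hx).2
    obtain ⟨hx1, hx2⟩ := Finset.mem_Icc.1 (Finset.mem_filter.1 hx).1
    have h1 : (x : ZMod q) * (inv x : ZMod q) = 1 := by
      have := (ZMod.intCast_eq_intCast_iff _ _ q).2 (hinv x hx1 hx2 hc)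
      exact_mod_cast this
    have h2 : (((ZMod.unitOfCoprime x hc)⁻¹ : (ZMod q)ˣ) : ZMod q) = inv x := by
      rw [Units.inv_eq_of_mul_eq_one_right]
      rw [ZMod.coe_unitOfCoprime, h1]
    rw [h2, ZMod.coe_unitOfCoprime]
    have h3 := ZMod.stdAddChar_coe (N := q) (m * x + n * inv x)
    push_cast at h3
    rw [h3, eAdd]
    congr 1
    push_cast
    ring

theorem weil_estermann_kloosterman_bound
    (q : ℕ) (hq : 0 < q) (m n : ℤ) (inv : ℕ → ℤ)
    (hinv : ∀ x : ℕ, 1 ≤ x → x ≤ q → Nat.gcd x q = 1 →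
      (x : ℤ) * inv x ≡ 1 [ZMOD (q : ℤ)]) :
    ‖∑ x ∈ (Finset.Icc 1 q).filter (fun x => Nat.gcd x q = 1),
        eAdd (((m * (x : ℤ) + n * inv x : ℤ) : ℝ) / (q : ℝ))‖ ≤
      (q.divisors.card : ℝ) * Real.sqrt q *
        Real.sqrt (Nat.gcd (Int.gcd m n) q) := by
  have : NeZero q := ⟨hq.ne'⟩
  rw [sum_exp_eq_kloostermanSum m n inv hinv]
  exact kloostermanBound hq.ne' m n
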